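/- arXiv:2405.09741 — 2 statements merged into one kernel-verified Lean document; each statement's English description precedes it below -/
import Mathlib

section
/- Fix δ ∈ (0,1) and θ > 0. Let (X_n)_{n≥0} be a Derrida–Retaux system such that, for some real s ∈ [1, m−δ] and some integer M ≥ 2: E( ((m−1)X_0 − 1)·s^{X_0} ) ≥ 0, E( ((m−1)X_0 − 1)·s^{X_0}·1_{{X_0 ≥ 1}} ) ≥ θ, and X_0 ≤ M almost surely. Then there exist a positive integer K_4 = K_4(m, δ, θ) and a constant K_5 = K_5(m, δ, θ) > 0 such that P(X_{M + K_4 + n} = 0) ≤ exp(−K_5 · m^n) for every integer n ≥ 0. -/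
noncomputable section

/-- One step of the Derrida–Retaux recursion on probability mass functions on ℕ:
the law of `(X_1 + ⋯ + X_m - 1)⁺` for independent `X_i` of law `μ`. -/
def drStep (m : ℕ) (μ : ℕ → ℝ) : ℕ → ℝ :=
  fun j => ∑' x : Fin m → ℕ, if (∑ i, x i) - 1 = j then ∏ i, μ (x i) else 0

open Polynomial Finset in
/-- DR step on generating polynomials. -/
def drT (m : ℕ) (P : ℝ[X]) : ℝ[X] := (P ^ m).divX + C (P.coeff 0 ^ m)

section DR
open Polynomial Finset

lemma coeff_pow_explicit (m N : ℕ) (P : ℝ[X]) (hN : P.natDegree < N) (k : ℕ) :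
    (P ^ m).coeff k = ∑ x ∈ Fintype.piFinset (fun _ : Fin m => Finset.range N),
      if (∑ i, x i) = k then ∏ i, P.coeff (x i) else 0 := by
  have h1 : P ^ m = ∏ _i : Fin m, ∑ j ∈ Finset.range N, monomial j (P.coeff j) := by
    rw [← Polynomial.as_sum_range' P N hN]; simp
  have h2 : ∀ x : Fin m → ℕ, ∏ i, (monomial (x i) (P.coeff (x i)) : ℝ[X])
      = monomial (∑ i, x i) (∏ i, P.coeff (x i)) := by
    intro x
    simp only [← C_mul_X_pow_eq_monomial, Finset.prod_mul_distrib, Finset.prod_pow_eq_pow_sum, map_prod]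
  rw [h1, Finset.prod_univ_sum, Polynomial.finsetSum_coeff]
  refine Finset.sum_congr rfl fun x _ => ?_
  rw [h2, coeff_monomial]

lemma coeff_drT (m : ℕ) (P : ℝ[X]) (j : ℕ) :
    (drT m P).coeff j = (P ^ m).coeff (j + 1) + if j = 0 then P.coeff 0 ^ m else 0 := by
  rw [drT, coeff_add, coeff_divX, coeff_C]

lemma drStep_coeff (m : ℕ) (P : ℝ[X]) :
    drStep m (fun j => P.coeff j) = fun j => (drT m P).coeff j := by
  funext j
  have hN : P.natDegree < P.natDegree + 1 := Nat.lt_succ_self _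
  unfold drStep
  rw [tsum_eq_sum (s := Fintype.piFinset (fun _ : Fin m => Finset.range (P.natDegree + 1)))]
  · rw [coeff_drT, coeff_pow_explicit m _ P hN]
    have h0 : P.coeff 0 ^ m = (P ^ m).coeff 0 := by simp [coeff_zero_eq_eval_zero]
    rw [h0, coeff_pow_explicit m _ P hN]
    by_cases hj : j = 0
    · subst hj
      rw [if_pos rfl, ← Finset.sum_add_distrib]
      refine Finset.sum_congr rfl fun x _ => ?_
      rcases Nat.lt_trichotomy (∑ i, x i) 1 with h | h | h
      · have : ∑ i, x i = 0 := by omega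
        simp only [this]; simp
      · simp only [h]; simp
      · rw [if_neg (by omega), if_neg (by omega), if_neg (by omega)]; simp
    · rw [if_neg hj, add_zero]
      refine Finset.sum_congr rfl fun x _ => ?_
      have : (∑ i, x i) - 1 = j ↔ ∑ i, x i = j + 1 := by omega
      simp only [this]
  · intro x hx
    simp only [Fintype.mem_piFinset, Finset.mem_range, not_forall, not_lt] at hx
    obtain ⟨i, hi⟩ := hx
    have : ∏ i, P.coeff (x i) = 0 :=
      Finset.prod_eq_zero (Finset.mem_univ i) (coeff_eq_zero_of_natDegree_lt (by omega))
    simp [this]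

lemma drStep_iterate (m : ℕ) (P : ℝ[X]) (n : ℕ) :
    (drStep m)^[n] (fun j => P.coeff j) = fun j => ((drT m)^[n] P).coeff j := by
  induction n with
  | zero => rfl
  | succ n ih => rw [Function.iterate_succ_apply', ih, drStep_coeff, Function.iterate_succ_apply']

/-- nonneg coefficients, total mass one -/
def IsLaw (P : ℝ[X]) : Prop := (∀ j, 0 ≤ P.coeff j) ∧ P.eval 1 = 1

lemma coeff_mul_nonneg {P Q : ℝ[X]} (hP : ∀ j, 0 ≤ P.coeff j) (hQ : ∀ j, 0 ≤ Q.coeff j) (j : ℕ) :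
    0 ≤ (P * Q).coeff j := by
  rw [coeff_mul]
  exact Finset.sum_nonneg fun x _ => mul_nonneg (hP _) (hQ _)

lemma coeff_pow_nonneg {P : ℝ[X]} (hP : ∀ j, 0 ≤ P.coeff j) (n : ℕ) : ∀ j, 0 ≤ (P ^ n).coeff j := by
  induction n with
  | zero => intro j; simp [coeff_one]; split_ifs <;> norm_num
  | succ n ih => rw [pow_succ]; exact coeff_mul_nonneg ih hP

lemma X_mul_drT (m : ℕ) (P : ℝ[X]) :
    drT m P * X = P ^ m + (X - 1) * C (P.coeff 0 ^ m) := by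
  have h := divX_mul_X_add (P ^ m)
  have h0 : (P ^ m).coeff 0 = P.coeff 0 ^ m := by simp [coeff_zero_eq_eval_zero]
  rw [h0] at h
  unfold drT
  linear_combination h

lemma drT_eval (m : ℕ) (P : ℝ[X]) (s : ℝ) :
    (drT m P).eval s * s = P.eval s ^ m + (s - 1) * P.coeff 0 ^ m := by
  have := congrArg (eval s) (X_mul_drT m P)
  simpa using this

lemma IsLaw.drT {P : ℝ[X]} (h : IsLaw P) (m : ℕ) : IsLaw (drT m P) := by
  refine ⟨fun j => ?_, ?_⟩
  · rw [coeff_drT]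
    have := coeff_pow_nonneg h.1 m (j + 1)
    have := pow_nonneg (h.1 0) m
    split_ifs <;> linarith
  · have := drT_eval m P 1
    simpa [h.2] using this

lemma IsLaw.iter {P : ℝ[X]} (h : IsLaw P) (m n : ℕ) : IsLaw ((_root_.drT m)^[n] P) := by
  induction n with
  | zero => exact h
  | succ n ih => rw [Function.iterate_succ_apply']; exact ih.drT m

/-- the functional `E(((m-1)X-1)s^X)` -/
def drH (m : ℕ) (s : ℝ) (P : ℝ[X]) : ℝ := ((m : ℝ) - 1) * (s * (derivative P).eval s) - P.eval s

lemma drH_drT (m : ℕ) (hm : 1 ≤ m) (P : ℝ[X]) (s : ℝ) :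
    s * drH m s (drT m P) = m * P.eval s ^ (m - 1) * drH m s P + (m - s) * P.coeff 0 ^ m := by
  have h1 := drT_eval m P s
  have h2 := congrArg (fun Q => eval s (derivative Q)) (X_mul_drT m P)
  simp [derivative_pow] at h2
  have h3 : P.eval s ^ m = P.eval s ^ (m - 1) * P.eval s := by
    rw [← pow_succ]; congr 1; omega
  unfold drH
  rw [h3] at h1
  linear_combination (((m : ℝ) - 1) * s) * h2 - (m : ℝ) * h1

lemma drH_eq_sum (m : ℕ) (s : ℝ) (P : ℝ[X]) (N : ℕ) (hN : P.natDegree < N) :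
    drH m s P = ∑ j ∈ Finset.range N, (((m : ℝ) - 1) * j - 1) * s ^ j * P.coeff j := by
  have hc : ∀ j, (X * derivative P).coeff j = j * P.coeff j := by
    intro j
    cases j with
    | zero => simp
    | succ j => rw [coeff_X_mul, coeff_derivative]; push_cast; ring
  have hd : (X * derivative P).natDegree < N := by
    refine lt_of_le_of_lt ?_ hN
    rw [natDegree_le_iff_coeff_eq_zero]
    intro j hj
    rw [hc, coeff_eq_zero_of_natDegree_lt hj, mul_zero]
  have h1 : s * (derivative P).eval s = (X * derivative P).eval s := by simp
  unfold drH
  rw [h1, eval_eq_sum_range' hd, eval_eq_sum_range' hN, Finset.mul_sum, ← Finset.sum_sub_distrib]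
  refine Finset.sum_congr rfl fun j _ => ?_
  rw [hc]; ring

/-- partial mass -/
def cdf (k : ℕ) (P : ℝ[X]) : ℝ := ∑ i ∈ Finset.range k, P.coeff i

lemma cdf_nonneg {P : ℝ[X]} (hP : ∀ j, 0 ≤ P.coeff j) (k : ℕ) : 0 ≤ cdf k P :=
  Finset.sum_nonneg fun i _ => hP i

lemma cdf_mul_le {P Q : ℝ[X]} (hP : ∀ j, 0 ≤ P.coeff j) (hQ : ∀ j, 0 ≤ Q.coeff j) (k : ℕ) :
    cdf k (P * Q) ≤ cdf k P * cdf k Q := by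
  unfold cdf
  simp only [coeff_mul]
  rw [Finset.sum_mul_sum, ← Finset.sum_product', Finset.sum_sigma']
  have hinj : Set.InjOn (fun x : (_ : ℕ) × (ℕ × ℕ) => x.2)
      ((Finset.range k).sigma fun i => antidiagonal i : Finset _) := by
    rintro ⟨i, a, b⟩ h1 ⟨i', a', b'⟩ h2 h
    simp at h1 h2 h
    obtain ⟨rfl, rfl⟩ := h
    obtain ⟨_, rfl⟩ := h1
    obtain ⟨_, rfl⟩ := h2
    rfl
  rw [← Finset.sum_image (f := fun x : ℕ × ℕ => P.coeff x.1 * Q.coeff x.2) hinj]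
  refine Finset.sum_le_sum_of_subset_of_nonneg ?_ fun x _ _ => mul_nonneg (hP _) (hQ _)
  intro x hx
  simp only [Finset.mem_image, Finset.mem_sigma, Finset.mem_range, HasAntidiagonal.mem_antidiagonal] at hx
  obtain ⟨⟨i, y⟩, ⟨h1, h2⟩, rfl⟩ := hx
  simp only [Finset.mem_product, Finset.mem_range] at *
  omega

lemma cdf_pow_le {P : ℝ[X]} (hP : ∀ j, 0 ≤ P.coeff j) {k : ℕ} (hk : 1 ≤ k) (n : ℕ) :
    cdf k (P ^ n) ≤ cdf k P ^ n := by
  induction n with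
  | zero =>
    simp only [pow_zero, cdf, coeff_one]
    rw [Finset.sum_ite_eq']
    split_ifs <;> norm_num
  | succ n ih =>
    rw [pow_succ, pow_succ]
    exact (cdf_mul_le (coeff_pow_nonneg hP n) hP k).trans
      (mul_le_mul_of_nonneg_right ih (cdf_nonneg hP k))

lemma cdf_drT_le (m : ℕ) {P : ℝ[X]} (hP : ∀ j, 0 ≤ P.coeff j) {k : ℕ} (hk : 1 ≤ k) :
    cdf k (drT m P) ≤ cdf (k + 1) P ^ m := by
  refine le_trans (le_of_eq ?_) (cdf_pow_le hP (by omega) m)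
  have h0 : P.coeff 0 ^ m = (P ^ m).coeff 0 := by simp [coeff_zero_eq_eval_zero]
  unfold cdf
  simp only [coeff_drT, Finset.sum_add_distrib]
  rw [Finset.sum_range_succ', Finset.sum_ite_eq', if_pos (by simp; omega), h0]

lemma cdf_iter_le (m : ℕ) {P : ℝ[X]} (hP : IsLaw P) (k l : ℕ) (hk : 1 ≤ k) :
    cdf k ((drT m)^[l] P) ≤ cdf (k + l) P ^ (m ^ l) := by
  induction l generalizing k with
  | zero => simp
  | succ l ih =>
    rw [Function.iterate_succ_apply']
    refine (cdf_drT_le m (hP.iter m l).1 hk).trans ?_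
    refine (pow_le_pow_left₀ (cdf_nonneg (hP.iter m l).1 _) (ih (k + 1) (by omega)) m).trans ?_
    rw [← pow_mul, ← pow_succ, add_right_comm, add_assoc]

lemma eval_eq_big {P : ℝ[X]} {N : ℕ} (hN : P.natDegree < N) (s : ℝ) :
    P.eval s = ∑ j ∈ Finset.range N, P.coeff j * s ^ j := eval_eq_sum_range' hN s

lemma IsLaw.sum_le {P : ℝ[X]} (h : IsLaw P) (S : Finset ℕ) : ∑ j ∈ S, P.coeff j ≤ 1 := by
  have hN : P.natDegree < P.natDegree + 1 := Nat.lt_succ_self _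
  have h1 := h.2
  rw [eval_eq_big hN] at h1
  simp only [one_pow, mul_one] at h1
  rw [← h1]
  have : ∑ j ∈ S, P.coeff j ≤ ∑ j ∈ S ∪ Finset.range (P.natDegree + 1), P.coeff j :=
    Finset.sum_le_sum_of_subset_of_nonneg Finset.subset_union_left fun x _ _ => h.1 x
  refine this.trans (le_of_eq ?_)
  symm
  refine Finset.sum_subset Finset.subset_union_right fun x _ hx => ?_
  simp only [Finset.mem_range, not_lt] at hx
  exact coeff_eq_zero_of_natDegree_lt (by omega)

lemma IsLaw.coeff_le_one {P : ℝ[X]} (h : IsLaw P) (j : ℕ) : P.coeff j ≤ 1 := by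
  simpa using h.sum_le {j}

lemma IsLaw.coeff_mul_le_eval {P : ℝ[X]} (h : IsLaw P) (j : ℕ) {s : ℝ} (hs : 0 ≤ s) :
    P.coeff j * s ^ j ≤ P.eval s := by
  have hN : P.natDegree < P.natDegree + 1 + j := by omega
  rw [eval_eq_big hN]
  exact Finset.single_le_sum (f := fun j => P.coeff j * s ^ j)
    (fun i _ => mul_nonneg (h.1 i) (pow_nonneg hs i)) (by simp)

lemma IsLaw.eval_nonneg {P : ℝ[X]} (h : IsLaw P) {s : ℝ} (hs : 0 ≤ s) : 0 ≤ P.eval s :=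
  (mul_nonneg (h.1 0) (pow_nonneg hs 0)).trans (h.coeff_mul_le_eval 0 hs)

lemma IsLaw.one_le_eval {P : ℝ[X]} (h : IsLaw P) {s : ℝ} (hs : 1 ≤ s) : 1 ≤ P.eval s := by
  have hN : P.natDegree < P.natDegree + 1 := Nat.lt_succ_self _
  rw [← h.2, eval_eq_big hN, eval_eq_big hN]
  refine Finset.sum_le_sum fun j _ => mul_le_mul_of_nonneg_left ?_ (h.1 j)
  rw [one_pow]; exact one_le_pow₀ hs

/-- eval at 1/2 bounded through the mass of {0,1} -/
lemma IsLaw.eval_half_le {P : ℝ[X]} (h : IsLaw P) : P.eval (1/2) ≤ cdf 2 P + 1/4 := by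
  have hN : P.natDegree < 2 + P.natDegree := by omega
  have hs := h.sum_le (Finset.range (2 + P.natDegree))
  rw [eval_eq_big hN]
  rw [Finset.sum_range_add] at hs ⊢
  have h2 : ∑ x ∈ Finset.range P.natDegree, P.coeff (2 + x) * (1/2 : ℝ) ^ (2 + x)
      ≤ ∑ x ∈ Finset.range P.natDegree, P.coeff (2 + x) * (1/4) := by
    refine Finset.sum_le_sum fun j _ => mul_le_mul_of_nonneg_left ?_ (h.1 _)
    rw [pow_add]
    have : (1/2 : ℝ) ^ j ≤ 1 := pow_le_one₀ (by norm_num) (by norm_num)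
    linarith
  rw [← Finset.sum_mul] at h2
  have h3 : ∑ x ∈ Finset.range 2, P.coeff x * (1/2 : ℝ) ^ x ≤ cdf 2 P := by
    unfold cdf
    refine Finset.sum_le_sum fun j _ => mul_le_of_le_one_right (h.1 _) ?_
    exact pow_le_one₀ (by norm_num) (by norm_num)
  have h4 : 0 ≤ ∑ x ∈ Finset.range 2, P.coeff x := cdf_nonneg h.1 2
  linarith

lemma good_step (m : ℕ) (hm : 2 ≤ m) {P : ℝ[X]} (h : IsLaw P) :
    2 * (drT m P).eval (1/2) ^ (m - 1) ≤ (2 * P.eval (1/2) ^ (m - 1)) ^ m := by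
  have h1 := drT_eval m P (1/2)
  have h0 := pow_nonneg (h.1 0) m
  have h2 : (drT m P).eval (1/2) ≤ 2 * P.eval (1/2) ^ m := by linarith
  have h3 := pow_le_pow_left₀ ((h.drT m).eval_nonneg (by norm_num)) h2 (m - 1)
  calc _ ≤ 2 * (2 * P.eval (1/2) ^ m) ^ (m - 1) := by linarith
    _ = _ := by
      rw [mul_pow, mul_pow, ← pow_mul, ← pow_mul, mul_comm m, ← mul_assoc, ← pow_succ']
      congr 2; omega

lemma good_iter (m : ℕ) (hm : 2 ≤ m) {P : ℝ[X]} (h : IsLaw P) (n : ℕ) :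
    2 * ((drT m)^[n] P).eval (1/2) ^ (m - 1) ≤ (2 * P.eval (1/2) ^ (m - 1)) ^ (m ^ n) := by
  induction n with
  | zero => simp
  | succ n ih =>
    rw [Function.iterate_succ_apply']
    refine (good_step m hm (h.iter m n)).trans ?_
    have h0 := pow_nonneg ((h.iter m n).eval_nonneg (s := 1/2) (by norm_num)) (m - 1)
    refine (pow_le_pow_left₀ (by linarith) ih m).trans (le_of_eq ?_)
    rw [← pow_mul, ← pow_succ]

/-- Conclusion from a small value of `P(X ≤ 1)`. -/
lemma good_final (m : ℕ) (hm : 2 ≤ m) {P : ℝ[X]} (h : IsLaw P) (hc : cdf 2 P ≤ 1/8)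
    (n n' : ℕ) (hn : n' ≤ n) :
    ((drT m)^[n] P).coeff 0 ≤ Real.exp (-(-Real.log (3/4) / (m - 1)) * (m : ℝ) ^ n') := by
  have hm1 : ((m - 1 : ℕ) : ℝ) = (m : ℝ) - 1 := by push_cast [Nat.cast_sub (show 1 ≤ m by omega)]; ring
  have hmr : (2 : ℝ) ≤ m := by exact_mod_cast hm
  have e0 := h.eval_nonneg (s := 1/2) (by norm_num)
  have e1 : P.eval (1/2) ≤ 3/8 := by linarith [h.eval_half_le]
  have e2 : P.eval (1/2) ^ (m - 1) ≤ 3/8 :=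
    (pow_le_of_le_one e0 (by linarith) (by omega)).trans e1
  have e3 := pow_nonneg e0 (m - 1)
  have g := good_iter m hm h n
  have g2 : (2 * P.eval (1/2) ^ (m - 1)) ^ (m ^ n) ≤ (3/4 : ℝ) ^ (m ^ n) :=
    pow_le_pow_left₀ (by linarith) (by linarith) _
  have g3 : (3/4 : ℝ) ^ (m ^ n) ≤ (3/4 : ℝ) ^ (m ^ n') :=
    pow_le_pow_of_le_one (by norm_num) (by norm_num) (Nat.pow_le_pow_right (by omega) hn)
  have hl := h.iter m n
  have c0 : ((drT m)^[n] P).coeff 0 ≤ ((drT m)^[n] P).eval (1/2) := by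
    simpa using hl.coeff_mul_le_eval 0 (s := 1/2) (by norm_num)
  have c1 := pow_le_pow_left₀ (hl.1 0) c0 (m - 1)
  have c2 := pow_nonneg (hl.1 0) (m - 1)
  have key : ((drT m)^[n] P).coeff 0 ^ (m - 1) ≤
      Real.exp (-(-Real.log (3/4) / (m - 1)) * (m : ℝ) ^ n') ^ (m - 1) := by
    rw [← Real.exp_nat_mul, hm1]
    have : ((m : ℝ) - 1) * (-(-Real.log (3/4) / (m - 1)) * (m : ℝ) ^ n')
        = ((m ^ n' : ℕ) : ℝ) * Real.log (3/4) := by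
      have : (m : ℝ) - 1 ≠ 0 := by linarith
      push_cast; field_simp
    rw [this, Real.exp_nat_mul, Real.exp_log (by norm_num)]
    linarith
  exact le_of_pow_le_pow_left₀ (by omega) (Real.exp_pos _).le key

/-- Heavy point implies quick growth. -/
lemma heavy_final (m : ℕ) (hm : 2 ≤ m) {P : ℝ[X]} (h : IsLaw P) (a : ℝ) (ha : 0 < a) (j : ℕ)
    (hj : 2 ≤ j) (hexp : Real.exp (-((m : ℝ) ^ (j - 2) * (a ^ j)⁻¹)) ≤ 1/8)
    (hheavy : (a ^ j)⁻¹ ≤ P.coeff j) (n n' : ℕ) (hn : j - 2 + n' ≤ n) :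
    ((drT m)^[n] P).coeff 0 ≤ Real.exp (-(-Real.log (3/4) / (m - 1)) * (m : ℝ) ^ n') := by
  have h1 := cdf_iter_le m h 2 (j - 2) (by norm_num)
  have h2 : 2 + (j - 2) = j := by omega
  rw [h2] at h1
  have h3 := h.sum_le (Finset.range (j + 1))
  rw [Finset.sum_range_succ] at h3
  have h4 : cdf j P ≤ Real.exp (-(a ^ j)⁻¹) := by
    have := Real.add_one_le_exp (-(a ^ j)⁻¹)
    unfold cdf; linarith
  have h5 := pow_le_pow_left₀ (cdf_nonneg h.1 j) h4 (m ^ (j - 2))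
  rw [← Real.exp_nat_mul] at h5
  have h6 : cdf 2 ((drT m)^[j - 2] P) ≤ 1/8 := by
    refine (h1.trans h5).trans (le_trans (le_of_eq ?_) hexp)
    push_cast; congr 1; ring
  have h7 := good_final m hm (h.iter m (j - 2)) h6 (n - (j - 2)) n' (by omega)
  rw [← Function.iterate_add_apply] at h7
  rwa [Nat.sub_add_cancel (by omega)] at h7

end DR

section DR2
open Polynomial Finset

lemma eval_iter_le (m : ℕ) {P : ℝ[X]} (h : IsLaw P) {b : ℝ} (hb : 1 ≤ b) (n : ℕ) :
    ((drT m)^[n] P).eval b ≤ P.eval b ^ (m ^ n) := by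
  induction n with
  | zero => simp
  | succ n ih =>
    rw [Function.iterate_succ_apply']
    have hl := h.iter m n
    have h1 := drT_eval m ((drT m)^[n] P) b
    have h2 : ((drT m)^[n] P).coeff 0 ^ m ≤ 1 := pow_le_one₀ (hl.1 0) (hl.coeff_le_one 0)
    have h3 : 1 ≤ ((drT m)^[n] P).eval b ^ m := one_le_pow₀ (hl.one_le_eval hb)
    have h4 : (drT m ((drT m)^[n] P)).eval b ≤ ((drT m)^[n] P).eval b ^ m := by
      by_contra hcon
      push Not at hcon
      nlinarith [mul_le_mul_of_nonneg_left (h2.trans h3) (sub_nonneg.2 hb)]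
    refine h4.trans ((pow_le_pow_left₀ (hl.eval_nonneg (by linarith)) ih m).trans (le_of_eq ?_))
    rw [← pow_mul, ← pow_succ]

lemma drH_growth (m : ℕ) (hm : 2 ≤ m) {P : ℝ[X]} (h : IsLaw P) {s S : ℝ} (hs : 1 ≤ s)
    (hsS : s ≤ S) (hS : S ≤ m) (η : ℝ) (hη : 0 ≤ η) (hH : η ≤ drH m s P) (n : ℕ) :
    η * (m / S) ^ n ≤ drH m s ((drT m)^[n] P) := by
  induction n with
  | zero => simpa
  | succ n ih =>
    rw [Function.iterate_succ_apply']
    have hl := h.iter m n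
    set Q := (drT m)^[n] P
    have hr := drH_drT m (by omega) Q s
    have h1 : 1 ≤ Q.eval s ^ (m - 1) := one_le_pow₀ (hl.one_le_eval hs)
    have h2 : 0 ≤ (m - s) * Q.coeff 0 ^ m :=
      mul_nonneg (by linarith) (pow_nonneg (hl.1 0) m)
    have hmS : 0 ≤ (m : ℝ) / S := div_nonneg (by positivity) (by linarith)
    have h3 : 0 ≤ η * (m / S) ^ n := mul_nonneg hη (pow_nonneg hmS n)
    have hm0 : (0 : ℝ) < m := by exact_mod_cast (by omega : 0 < m)
    have h4 : m * drH m s Q ≤ s * drH m s (drT m Q) := by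
      rw [hr]
      nlinarith [mul_nonneg (mul_nonneg hm0.le (sub_nonneg.2 h1)) (h3.trans ih)]
    have h5 : 0 ≤ drH m s (drT m Q) := by
      by_contra hc
      push Not at hc
      nlinarith [mul_nonneg hm0.le (h3.trans ih)]
    have h6 : m * (η * (m / S) ^ n) ≤ S * drH m s (drT m Q) := by
      nlinarith [mul_le_mul_of_nonneg_right hsS h5, mul_le_mul_of_nonneg_left ih hm0.le]
    have hS0 : 0 < S := by linarith
    calc η * (m / S) ^ (n + 1) = (m * (η * (m / S) ^ n)) / S := by rw [pow_succ]; ring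
      _ ≤ (S * drH m s (drT m Q)) / S := by gcongr
      _ = _ := by field_simp

lemma drH_first (m : ℕ) (hm : 2 ≤ m) {P : ℝ[X]} (h : IsLaw P) {s δ θ : ℝ} (hs : 1 ≤ s)
    (hsd : s ≤ m - δ) (hδ : 0 < δ) (hθ : 0 < θ)
    (hH : 0 ≤ drH m s P) (hT : θ ≤ drH m s P + P.coeff 0) :
    min (θ / 2) (δ / m * (θ / 2) ^ m) ≤ drH m s (drT m P) := by
  have hm0 : (0 : ℝ) < m := by exact_mod_cast (by omega : 0 < m)
  have hr := drH_drT m (by omega) P s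
  have h1 : 1 ≤ P.eval s ^ (m - 1) := one_le_pow₀ (h.one_le_eval hs)
  have hp := pow_nonneg (h.1 0) m
  have h4 : m * drH m s P + δ * P.coeff 0 ^ m ≤ s * drH m s (drT m P) := by
    rw [hr]
    nlinarith [mul_nonneg (mul_nonneg hm0.le (sub_nonneg.2 h1)) hH,
      mul_nonneg (by linarith : 0 ≤ m - s - δ) hp]
  have h5 : 0 ≤ drH m s (drT m P) := by
    by_contra hc
    push Not at hc
    nlinarith [mul_nonneg hm0.le hH, mul_nonneg hδ.le hp]
  have h6 : m * drH m s P + δ * P.coeff 0 ^ m ≤ m * drH m s (drT m P) := by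
    nlinarith [mul_le_mul_of_nonneg_right (by linarith : s ≤ m) h5]
  by_cases hc : θ / 2 ≤ P.coeff 0
  · refine (min_le_right _ _).trans ?_
    have h7 := pow_le_pow_left₀ (by linarith) hc m
    have h8 : δ * (θ / 2) ^ m ≤ m * drH m s (drT m P) := by
      nlinarith [mul_nonneg hm0.le hH, mul_le_mul_of_nonneg_left h7 hδ.le]
    rw [div_mul_eq_mul_div, div_le_iff₀ hm0]
    linarith
  · refine (min_le_left _ _).trans ?_
    push Not at hc
    have h8 : m * (θ / 2) ≤ m * drH m s (drT m P) := by
      nlinarith [mul_nonneg hδ.le hp, mul_le_mul_of_nonneg_left (by linarith : θ / 2 ≤ drH m s P) hm0.le]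
    exact le_of_mul_le_mul_left h8 hm0

/-- upper bound for `drH` under a tail bound. -/
lemma drH_le (m : ℕ) (hm : 2 ≤ m) {P : ℝ[X]} (h : IsLaw P) {s S c : ℝ} (hs : 1 ≤ s)
    (hsS : s ≤ S) (hSc : S < c) (J : ℕ) (htail : ∀ j, J ≤ j → P.coeff j ≤ (c ^ j)⁻¹) :
    drH m s P ≤ m * J * S ^ J + m * ∑' j : ℕ, (j : ℝ) * (S / c) ^ j := by
  have hm0 : (2 : ℝ) ≤ m := by exact_mod_cast hm
  have hS1 : 1 ≤ S := hs.trans hsS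
  have hc0 : 0 < c := by linarith
  have hq0 : 0 ≤ S / c := by positivity
  have hq1 : S / c < 1 := by rw [div_lt_one hc0]; exact hSc
  have hsum : Summable fun j : ℕ => (j : ℝ) * (S / c) ^ j := by
    simpa using summable_pow_mul_geometric_of_norm_lt_one 1 (r := S / c)
      (by rw [Real.norm_of_nonneg hq0]; exact hq1)
  have hN : P.natDegree < J + (P.natDegree + 1) := by omega
  rw [drH_eq_sum m s P _ hN]
  have hterm : ∀ j : ℕ, (((m : ℝ) - 1) * j - 1) * s ^ j * P.coeff j
      ≤ (if j < J then m * J * S ^ J * P.coeff j else 0) + m * ((j : ℝ) * (S / c) ^ j) := by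
    intro j
    have hj0 : (0 : ℝ) ≤ j := Nat.cast_nonneg j
    have hsp : s ^ j ≤ S ^ j := pow_le_pow_left₀ (by linarith) hsS j
    have h0 := h.1 j
    have hsp0 : 0 ≤ s ^ j := by positivity
    have e1 : (((m : ℝ) - 1) * j - 1) * s ^ j * P.coeff j ≤ m * j * S ^ j * P.coeff j := by
      refine mul_le_mul_of_nonneg_right ?_ h0
      refine (mul_le_mul_of_nonneg_right (by linarith : ((m : ℝ) - 1) * j - 1 ≤ m * j) hsp0).trans ?_
      exact mul_le_mul_of_nonneg_left hsp (by positivity)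
    refine e1.trans ?_
    split_ifs with hj
    · have e2 : m * j * S ^ j * P.coeff j ≤ m * J * S ^ J * P.coeff j := by
        refine mul_le_mul_of_nonneg_right ?_ h0
        have : (j : ℝ) ≤ J := by exact_mod_cast hj.le
        have : S ^ j ≤ S ^ J := pow_le_pow_right₀ hS1 hj.le
        gcongr
      have : 0 ≤ m * ((j : ℝ) * (S / c) ^ j) := by positivity
      linarith
    · have := htail j (by omega)
      rw [zero_add, div_pow, div_eq_mul_inv]
      calc _ ≤ m * j * S ^ j * (c ^ j)⁻¹ := by gcongr
        _ = _ := by ring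
  refine (Finset.sum_le_sum fun j _ => hterm j).trans ?_
  rw [Finset.sum_add_distrib, ← Finset.mul_sum, ← Finset.sum_filter, ← Finset.mul_sum]
  have a1 : m * J * S ^ J * ∑ i ∈ Finset.range (J + (P.natDegree + 1)) with i < J, P.coeff i
      ≤ m * J * S ^ J := mul_le_of_le_one_right (by positivity) (h.sum_le _)
  have a2 := hsum.sum_le_tsum (Finset.range (J + (P.natDegree + 1))) (fun j _ => by positivity)
  have a3 := mul_le_mul_of_nonneg_left a2 (by linarith : (0 : ℝ) ≤ m)
  linarith

lemma eval_le (P : ℝ[X]) (h : IsLaw P) {b a : ℝ} (hb : 1 ≤ b)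
    (hba : b < a) (J : ℕ) (htail : ∀ j, J ≤ j → P.coeff j ≤ (a ^ j)⁻¹) :
    P.eval b ≤ b ^ J + (1 - b / a)⁻¹ := by
  have ha0 : 0 < a := by linarith
  have hq0 : 0 ≤ b / a := by positivity
  have hq1 : b / a < 1 := by rw [div_lt_one ha0]; exact hba
  have hsum := summable_geometric_of_lt_one hq0 hq1
  have hN : P.natDegree < J + (P.natDegree + 1) := by omega
  rw [eval_eq_big hN]
  have hterm : ∀ j : ℕ, P.coeff j * b ^ j
      ≤ (if j < J then b ^ J * P.coeff j else 0) + (b / a) ^ j := by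
    intro j
    have h0 := h.1 j
    split_ifs with hj
    · have : b ^ j ≤ b ^ J := pow_le_pow_right₀ hb hj.le
      have : 0 ≤ (b / a) ^ j := by positivity
      nlinarith
    · have := htail j (by omega)
      rw [zero_add, div_pow, div_eq_inv_mul]
      gcongr
  refine (Finset.sum_le_sum fun j _ => hterm j).trans ?_
  rw [Finset.sum_add_distrib, ← Finset.sum_filter, ← Finset.mul_sum]
  have a1 : b ^ J * ∑ i ∈ Finset.range (J + (P.natDegree + 1)) with i < J, P.coeff i
      ≤ b ^ J := mul_le_of_le_one_right (by positivity) (h.sum_le _)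
  have a2 := hsum.sum_le_tsum (Finset.range (J + (P.natDegree + 1))) (fun j _ => by positivity)
  rw [tsum_geometric_of_lt_one hq0 hq1] at a2
  linarith

lemma exists_J (m : ℕ) (hm : 2 ≤ m) (a : ℝ) (ha : 0 < a) (ham : a < m) :
    ∃ J : ℕ, 2 ≤ J ∧ ∀ j, J ≤ j → Real.exp (-((m : ℝ) ^ (j - 2) * (a ^ j)⁻¹)) ≤ 1/8 := by
  have hm0 : (0 : ℝ) < m := by exact_mod_cast (by omega : 0 < m)
  have hr : 1 < (m : ℝ) / a := by rw [one_lt_div ha]; exact ham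
  obtain ⟨J, hJ⟩ := pow_unbounded_of_one_lt ((m : ℝ) ^ 2 * 8) hr
  refine ⟨J + 2, by omega, fun j hj => ?_⟩
  have h1 : (m : ℝ) ^ 2 * 8 ≤ (m / a) ^ j := hJ.le.trans (pow_le_pow_right₀ hr.le (by omega))
  have h2 : (m : ℝ) ^ (j - 2) * (a ^ j)⁻¹ = (m / a) ^ j / m ^ 2 := by
    obtain ⟨i, rfl⟩ : ∃ i, j = i + 2 := ⟨j - 2, by omega⟩
    rw [Nat.add_sub_cancel, div_pow, pow_add (m : ℝ)]
    field_simp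
  have h3 : 8 ≤ (m : ℝ) ^ (j - 2) * (a ^ j)⁻¹ := by
    rw [h2, le_div_iff₀ (by positivity)]; linarith
  rw [Real.exp_neg, one_div]
  refine inv_anti₀ (by norm_num) ?_
  linarith [Real.add_one_le_exp ((m : ℝ) ^ (j - 2) * (a ^ j)⁻¹)]

lemma main_poly (m : ℕ) (hm : 2 ≤ m) (δ : ℝ) (hδ : δ ∈ Set.Ioo (0 : ℝ) 1) (θ : ℝ) (hθ : 0 < θ) :
    ∃ K4 : ℕ, 0 < K4 ∧ ∃ K5 : ℝ, 0 < K5 ∧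
      ∀ P : ℝ[X], IsLaw P → ∀ s : ℝ, 1 ≤ s → s ≤ (m : ℝ) - δ →
      ∀ M : ℕ, (∀ j, M < j → P.coeff j = 0) →
        0 ≤ drH m s P → θ ≤ drH m s P + P.coeff 0 →
        ∀ n : ℕ, ((drT m)^[M + K4 + n] P).coeff 0 ≤ Real.exp (-K5 * (m : ℝ) ^ n) := by
  obtain ⟨hδ0, hδ1⟩ := hδ
  have hm2 : (2 : ℝ) ≤ m := by exact_mod_cast hm
  set a : ℝ := m - δ / 4 with ha
  set b : ℝ := m - δ / 2 with hb
  set c : ℝ := m - 3 * δ / 4 with hc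
  set S : ℝ := m - δ with hS
  obtain ⟨J, hJ2, hJ⟩ := exists_J m hm a (by linarith) (by linarith)
  set η : ℝ := min (θ / 2) (δ / m * (θ / 2) ^ m) with hη
  have hη0 : 0 < η := by
    rw [hη]; refine lt_min (by linarith) (by positivity)
  set B : ℝ := m * J * S ^ J + m * ∑' j : ℕ, (j : ℝ) * (S / c) ^ j with hB
  have hmS : 1 < (m : ℝ) / S := by rw [one_lt_div (by linarith)]; linarith
  obtain ⟨n0, hn0⟩ := pow_unbounded_of_one_lt (B / η) hmS
  have hn0' : B < η * (m / S) ^ n0 := by rw [div_lt_iff₀ hη0] at hn0; linarith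
  set C1 : ℝ := (b ^ J + (1 - b / a)⁻¹) ^ (m ^ (n0 + 1)) with hC1
  have hbc : 1 < b / c := by rw [one_lt_div (by linarith)]; linarith
  obtain ⟨J1, hJ1⟩ := pow_unbounded_of_one_lt C1 hbc
  refine ⟨n0 + 1 + J1, by omega, -Real.log (3/4) / (m - 1), ?_, ?_⟩
  · exact div_pos (neg_pos.2 (Real.log_neg (by norm_num) (by norm_num))) (by linarith)
  intro P hP s hs hsS M hM hH hT n
  by_cases hcase : ∃ j, J ≤ j ∧ (a ^ j)⁻¹ ≤ P.coeff j
  · obtain ⟨j, hj, hheavy⟩ := hcase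
    have hjM : j ≤ M := by
      by_contra hcon
      rw [hM j (by omega)] at hheavy
      have : 0 < (a ^ j)⁻¹ := inv_pos.2 (pow_pos (by linarith) j)
      linarith
    exact heavy_final m hm hP a (by linarith) j (by omega) (hJ j hj) hheavy _ n (by omega)
  push Not at hcase
  have hG := eval_le P hP (b := b) (a := a) (by linarith) (by linarith) J (fun j hj => (hcase j hj).le)
  have hGn : ((drT m)^[n0 + 1] P).eval b ≤ C1 :=
    (eval_iter_le m hP (by linarith) (n0 + 1)).trans
      (pow_le_pow_left₀ (hP.eval_nonneg (by linarith)) hG _)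
  have hL := hP.iter m (n0 + 1)
  have hgrow := drH_growth m hm (hP.drT m) hs hsS (by linarith) η hη0.le
    (drH_first m hm hP hs hsS hδ0 hθ hH hT) n0
  rw [← Function.iterate_succ_apply] at hgrow
  have hex : ∃ j, J ≤ j ∧ j < J1 ∧ (a ^ j)⁻¹ ≤ ((drT m)^[n0 + 1] P).coeff j := by
    by_contra hcon
    push Not at hcon
    have := drH_le m hm hL (S := S) (c := c) hs hsS (by linarith) J (by
      intro j hj
      have hc0 : 0 < c := by linarith
      by_cases hjJ : j < J1
      · refine (hcon j hj hjJ).le.trans ?_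
        exact inv_anti₀ (pow_pos hc0 j) (pow_le_pow_left₀ hc0.le (by linarith) j)
      · have h1 := hL.coeff_mul_le_eval j (s := b) (by linarith)
        have h2 : C1 ≤ (b / c) ^ j := hJ1.le.trans (pow_le_pow_right₀ hbc.le (by omega))
        have h3 := (h1.trans hGn).trans h2
        have hbj : 0 < b ^ j := pow_pos (by linarith) j
        rw [div_pow, div_eq_mul_inv, mul_comm] at h3
        exact le_of_mul_le_mul_left h3 hbj)
    linarith
  obtain ⟨j, hj, hj1, hheavy⟩ := hex
  have := heavy_final m hm hL a (by linarith) j (by omega) (hJ j hj) hheavy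
    (M + J1 + n) n (by omega)
  rw [← Function.iterate_add_apply] at this
  rwa [show M + J1 + n + (n0 + 1) = M + (n0 + 1 + J1) + n by ring] at this

end DR2

/-- Lemma 4.3. Fix `δ ∈ (0,1)` and `θ > 0`. There are `K_4 ∈ ℕ⁺`
and `K_5 > 0` depending only on `(m, δ, θ)` such that: for any Derrida–Retaux system,
any `s ∈ [1, m-δ]` and any integer `M ≥ 2` with `E(((m-1)X_0-1)s^{X_0}) ≥ 0`,
`E(((m-1)X_0-1)s^{X_0}1_{X_0 ≥ 1}) ≥ θ` and `X_0 ≤ M` a.s., one has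
`P(X_{M+K_4+n} = 0) ≤ exp(-K_5 m^n)` for all `n ≥ 0`. -/
theorem bounded_generating_doubly_exponential
    (m : ℕ) (hm : 2 ≤ m) (δ : ℝ) (hδ : δ ∈ Set.Ioo (0 : ℝ) 1) (θ : ℝ) (hθ : 0 < θ) :
    ∃ K4 : ℕ, 0 < K4 ∧ ∃ K5 : ℝ, 0 < K5 ∧
      ∀ μ : ℕ → ℝ, (∀ j, 0 ≤ μ j) → (∑' j, μ j) = 1 →
      ∀ s : ℝ, 1 ≤ s → s ≤ (m : ℝ) - δ →
      ∀ M : ℕ, 2 ≤ M → (∀ j, M < j → μ j = 0) →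
        0 ≤ ∑ j ∈ Finset.range (M + 1),
              (((m : ℝ) - 1) * j - 1) * s ^ j * μ j →
        θ ≤ ∑ j ∈ Finset.Icc 1 M,
              (((m : ℝ) - 1) * j - 1) * s ^ j * μ j →
        ∀ n : ℕ, ((drStep m)^[M + K4 + n] μ) 0 ≤ Real.exp (-K5 * (m : ℝ) ^ n) := by
  obtain ⟨K4, hK4, K5, hK5, H⟩ := main_poly m hm δ hδ θ hθ
  refine ⟨K4, hK4, K5, hK5, ?_⟩
  intro μ hμ hsum s hs1 hs2 M hM hsupp hH hT n
  set P : Polynomial ℝ := ∑ j ∈ Finset.range (M + 1), Polynomial.monomial j (μ j) with hPdef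
  have hco : ∀ j, P.coeff j = μ j := by
    intro j
    rw [hPdef, Polynomial.finsetSum_coeff]
    simp only [Polynomial.coeff_monomial]
    rw [Finset.sum_ite_eq']
    split_ifs with h
    · rfl
    · rw [hsupp j (by simp at h; omega)]
  have hdeg : P.natDegree < M + 1 := by
    rw [Nat.lt_succ_iff, Polynomial.natDegree_le_iff_coeff_eq_zero]
    intro j hj
    rw [hco, hsupp j hj]
  have hlaw : IsLaw P := by
    refine ⟨fun j => by rw [hco]; exact hμ j, ?_⟩
    rw [tsum_eq_sum (s := Finset.range (M + 1))] at hsum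
    · rw [eval_eq_big hdeg]
      simpa [hco] using hsum
    · intro j hj
      exact hsupp j (by simp at hj; omega)
  have hHeq : drH m s P = ∑ j ∈ Finset.range (M + 1),
      (((m : ℝ) - 1) * j - 1) * s ^ j * μ j := by
    rw [drH_eq_sum m s P _ hdeg]; simp only [hco]
  have hsplit : drH m s P + P.coeff 0 = ∑ j ∈ Finset.Icc 1 M,
      (((m : ℝ) - 1) * j - 1) * s ^ j * μ j := by
    have hins : Finset.range (M + 1) = insert 0 (Finset.Icc 1 M) := by
      ext x; simp; omega
    rw [hHeq, hins, Finset.sum_insert (by simp), hco]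
    simp
  have hμP : μ = fun j => P.coeff j := by funext j; rw [hco]
  rw [hμP, drStep_iterate]
  exact H P hlaw s hs1 hs2 M (fun j hj => by rw [hco, hsupp j hj]) (by rw [hHeq]; exact hH)
    (by rw [hsplit]; exact hT) n
end
end

section
/- Fix δ ∈ (0,1), assume c_1 := P(X_0^* ≥ 2) > 0, and let M ≥ n_2 + 2 be an integer. Suppose that for some integer i with n_2 ≤ i ≤ M − 2 and some real s ∈ [1, m−δ], one has E( ((m−1)·X_i^{(M)} − 1)·s^{X_i^{(M)}} ) ≥ 0. Then there exist constants c_6 = c_6(m, δ) > 0 and c_7 = c_7(m, δ) > 0 such that P(X_n = 0) ≤ c_7 · exp(−c_6 · m^{n−M}) for every integer n ≥ M. -/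
noncomputable section

/-- The mass function of `X_0`, namely `(1 - p)·δ_0 + p·ν`. -/
def mix (ν : ℕ → ℝ) (p : ℝ) : ℕ → ℝ :=
  fun k => (1 - p) * (if k = 0 then 1 else 0) + p * ν k

/-- The mass function of `X_n`. -/
def drLaw (m : ℕ) (ν : ℕ → ℝ) (p : ℝ) (n : ℕ) : ℕ → ℝ :=
  (drStep m)^[n] (mix ν p)


namespace DR

open Polynomial

/-- One step on polynomials. -/
def T (m : ℕ) (P : ℝ[X]) : ℝ[X] := (P ^ m).divX + C (P.coeff 0 ^ m)

/-- Polynomial is the generating function of a probability. -/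
def Prob (P : ℝ[X]) : Prop := (∀ k, 0 ≤ P.coeff k) ∧ P.eval 1 = 1

lemma coeff0_pow (P : ℝ[X]) (m : ℕ) : (P ^ m).coeff 0 = P.coeff 0 ^ m := by
  simp [coeff_zero_eq_eval_zero]

lemma T_mul_X (m : ℕ) (P : ℝ[X]) :
    T m P * X = P ^ m - C (P.coeff 0 ^ m) + C (P.coeff 0 ^ m) * X := by
  have := divX_mul_X_add (P ^ m)
  rw [coeff0_pow] at this
  unfold T
  rw [add_mul, eq_sub_of_add_eq this]

lemma coeff_mul_nonneg {P Q : ℝ[X]} (hP : ∀ k, 0 ≤ P.coeff k) (hQ : ∀ k, 0 ≤ Q.coeff k) (k : ℕ) :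
    0 ≤ (P * Q).coeff k := by
  rw [coeff_mul]
  exact Finset.sum_nonneg fun x _ => mul_nonneg (hP _) (hQ _)

lemma coeff_pow_nonneg {P : ℝ[X]} (hP : ∀ k, 0 ≤ P.coeff k) (m : ℕ) : ∀ k, 0 ≤ (P ^ m).coeff k := by
  induction m with
  | zero => intro k; rw [pow_zero, coeff_one]; split_ifs <;> norm_num
  | succ n ih => intro k; rw [pow_succ]; exact coeff_mul_nonneg ih hP k

lemma T_nonneg {P : ℝ[X]} (hP : ∀ k, 0 ≤ P.coeff k) (m : ℕ) : ∀ k, 0 ≤ (T m P).coeff k := by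
  intro k
  unfold T
  rw [coeff_add, coeff_divX, coeff_C]
  have := coeff_pow_nonneg hP m (k+1)
  split_ifs
  · have := pow_nonneg (hP 0) m; linarith
  · linarith

lemma T_eval (m : ℕ) (P : ℝ[X]) (x : ℝ) :
    (T m P).eval x * x = P.eval x ^ m - P.coeff 0 ^ m + P.coeff 0 ^ m * x := by
  have := congrArg (eval x) (T_mul_X m P)
  simpa using this

lemma Prob.T {P : ℝ[X]} (hP : Prob P) (m : ℕ) : Prob (T m P) := by
  refine ⟨T_nonneg hP.1 m, ?_⟩
  have := T_eval m P 1
  rw [hP.2] at this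
  simpa using this

lemma Prob.iter {P : ℝ[X]} (hP : Prob P) (m n : ℕ) : Prob ((DR.T m)^[n] P) := by
  induction n with
  | zero => simpa
  | succ n ih => rw [Function.iterate_succ_apply']; exact ih.T m

/-- The functional `E(((m-1)X-1)s^X)`. -/
def H (m : ℕ) (P : ℝ[X]) (s : ℝ) : ℝ := ((m : ℝ) - 1) * (s * P.derivative.eval s) - P.eval s

lemma H_T (m : ℕ) (P : ℝ[X]) (s : ℝ) :
    s * H m (T m P) s = m * P.eval s ^ (m - 1) * H m P s + (m - s) * P.coeff 0 ^ m := by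
  rcases Nat.eq_zero_or_pos m with rfl | hm
  · have h1 := T_eval 0 P s
    have h2 := congrArg (fun Q => eval s (derivative Q)) (T_mul_X 0 P)
    simp at h1 h2
    unfold H
    simp
    linear_combination (-s) * h2
  have h1 := T_eval m P s
  have h2 := congrArg (fun Q => eval s (derivative Q)) (T_mul_X m P)
  simp [derivative_pow] at h2
  unfold H
  obtain ⟨k, rfl⟩ : ∃ k, m = k + 1 := ⟨m - 1, by omega⟩
  simp only [Nat.add_sub_cancel, Nat.cast_add, Nat.cast_one] at *
  rw [pow_succ] at h1
  linear_combination (k : ℝ) * s * h2 - (k+1) * h1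

lemma coeff_zero_le_eval {P : ℝ[X]} (hP : ∀ k, 0 ≤ P.coeff k) {x : ℝ} (hx : 0 ≤ x) :
    P.coeff 0 ≤ P.eval x := by
  rw [eval_eq_sum_range]
  have := Finset.single_le_sum (f := fun i => P.coeff i * x ^ i) (s := Finset.range (P.natDegree + 1))
    (fun i _ => mul_nonneg (hP i) (pow_nonneg hx i)) (a := 0) (by simp)
  simpa using this

lemma eval_nonneg' {P : ℝ[X]} (hP : ∀ k, 0 ≤ P.coeff k) {x : ℝ} (hx : 0 ≤ x) : 0 ≤ P.eval x :=
  (hP 0).trans (coeff_zero_le_eval hP hx)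

lemma eval_mono' {P : ℝ[X]} (hP : ∀ k, 0 ≤ P.coeff k) {x y : ℝ} (hx : 0 ≤ x) (hxy : x ≤ y) :
    P.eval x ≤ P.eval y := by
  rw [eval_eq_sum_range, eval_eq_sum_range]
  refine Finset.sum_le_sum fun i _ => mul_le_mul_of_nonneg_left (by gcongr) (hP i)

lemma H_T_le {m : ℕ} {P : ℝ[X]} (hP : Prob P) {s : ℝ} (hs : 1 ≤ s)
    (hH : 0 ≤ H m P s) :
    m / s * H m P s + (m - s) / s * P.coeff 0 ^ m ≤ H m (T m P) s := by
  have h := H_T m P s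
  have hs0 : 0 < s := by linarith
  have h1 : 1 ≤ P.eval s ^ (m - 1) := one_le_pow₀ (hP.2 ▸ eval_mono' hP.1 zero_le_one hs)
  have h2 : (m : ℝ) * H m P s ≤ m * P.eval s ^ (m - 1) * H m P s := by
    have : 0 ≤ (m : ℝ) * H m P s := by positivity
    nlinarith
  have : m / s * H m P s + (m - s) / s * P.coeff 0 ^ m =
    (m * H m P s + (m - s) * P.coeff 0 ^ m) / s := by ring
  rw [this, div_le_iff₀ hs0]
  linarith

/-- `2^{-(m-1)}`-transform, `F_n = 2 G_n(2^{-(m-1)})`. -/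
def F (m : ℕ) (P : ℝ[X]) : ℝ := 2 * P.eval ((1 / 2) ^ (m - 1))

lemma F_nonneg {m : ℕ} {P : ℝ[X]} (hP : ∀ k, 0 ≤ P.coeff k) : 0 ≤ F m P := by
  unfold F
  have := eval_nonneg' hP (x := (1 / 2) ^ (m - 1)) (by positivity)
  linarith

lemma F_T {m : ℕ} (hm : 2 ≤ m) {P : ℝ[X]} (hP : ∀ k, 0 ≤ P.coeff k) : F m (T m P) ≤ F m P ^ m := by
  unfold F
  set x : ℝ := (1 / 2) ^ (m - 1) with hx
  have hx0 : 0 < x := by positivity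
  have hx1 : x ≤ 1 := pow_le_one₀ (by norm_num) (by norm_num)
  have h := T_eval m P x
  have h2 : (2 : ℝ) ^ m * x = 2 := by
    obtain ⟨k, rfl⟩ : ∃ k, m = k + 1 := ⟨m - 1, by omega⟩
    rw [hx, Nat.add_sub_cancel, pow_succ, mul_right_comm, ← mul_pow]; norm_num
  have h3 : (T m P).eval x * x ≤ P.eval x ^ m := by
    have := pow_nonneg (hP 0) m
    nlinarith
  rw [mul_pow]
  have h4 := mul_le_mul_of_nonneg_left h3 (show (0 : ℝ) ≤ 2 ^ m by positivity)
  calc 2 * (T m P).eval x = 2 ^ m * ((T m P).eval x * x) := by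
        rw [mul_comm (eval x (T m P)) x, ← mul_assoc, h2]
    _ ≤ _ := h4

lemma F_iter {m : ℕ} (hm : 2 ≤ m) {P : ℝ[X]} (hP : ∀ k, 0 ≤ P.coeff k) (n : ℕ) :
    F m ((T m)^[n] P) ≤ F m P ^ (m ^ n) := by
  induction n generalizing P with
  | zero => simp
  | succ n ih =>
    rw [Function.iterate_succ_apply, pow_succ', pow_mul]
    exact (ih (T_nonneg hP m)).trans (pow_le_pow_left₀ (F_nonneg (T_nonneg hP m)) (F_T hm hP) _)

lemma coeff_zero_le_F {m : ℕ} {P : ℝ[X]} (hP : ∀ k, 0 ≤ P.coeff k) : P.coeff 0 ≤ F m P := by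
  unfold F
  have := coeff_zero_le_eval hP (x := (1 / 2) ^ (m - 1)) (by positivity)
  have := hP 0
  linarith

/-- partial sums -/
def S (P : ℝ[X]) (k : ℕ) : ℝ := ∑ j ∈ Finset.range k, P.coeff j

lemma S_nonneg {P : ℝ[X]} (hP : ∀ k, 0 ≤ P.coeff k) (k : ℕ) : 0 ≤ S P k :=
  Finset.sum_nonneg fun _ _ => hP _

lemma S_mul {P Q : ℝ[X]} (hP : ∀ k, 0 ≤ P.coeff k) (hQ : ∀ k, 0 ≤ Q.coeff k) (k : ℕ) :
    S (P * Q) k ≤ S P k * S Q k := by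
  unfold S
  rw [Finset.sum_mul_sum, ← Finset.sum_product']
  simp_rw [coeff_mul]
  rw [← Finset.sum_biUnion]
  · refine Finset.sum_le_sum_of_subset_of_nonneg ?_ ?_
    · intro x hx
      simp only [Finset.mem_biUnion, Finset.mem_range, Finset.HasAntidiagonal.mem_antidiagonal] at hx
      obtain ⟨a, ha, h⟩ := hx
      simp only [Finset.mem_product, Finset.mem_range]
      omega
    · intro x _ _
      exact mul_nonneg (hP _) (hQ _)
  · intro a _ b _ hab
    rw [Function.onFun, Finset.disjoint_left]
    intro x hx hx'
    simp only [Finset.HasAntidiagonal.mem_antidiagonal] at hx hx'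
    omega

lemma S_pow {P : ℝ[X]} (hP : ∀ k, 0 ≤ P.coeff k) (m k : ℕ) : S (P ^ m) k ≤ S P k ^ m := by
  induction m with
  | zero =>
    unfold S
    simp only [pow_zero, coeff_one]
    rw [Finset.sum_ite_eq' (Finset.range k) 0]
    split_ifs <;> norm_num
  | succ n ih =>
    rw [pow_succ, pow_succ]
    exact (S_mul (coeff_pow_nonneg hP n) hP k).trans
      (mul_le_mul_of_nonneg_right ih (S_nonneg hP k))

lemma S_T {P : ℝ[X]} (hP : ∀ k, 0 ≤ P.coeff k) (m k : ℕ) : S (T m P) (k + 1) ≤ S P (k + 2) ^ m := by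
  refine le_trans (le_of_eq ?_) (S_pow hP m (k + 2))
  unfold S T
  simp only [coeff_add, coeff_divX, coeff_C, Finset.sum_add_distrib]
  rw [Finset.sum_range_succ' (fun j => (P ^ m).coeff j) (k + 1), coeff0_pow]
  simp

lemma S_iter {P : ℝ[X]} (hP : ∀ k, 0 ≤ P.coeff k) (m n k : ℕ) :
    S ((T m)^[n] P) (k + 1) ≤ S P (k + n + 1) ^ (m ^ n) := by
  induction n generalizing P with
  | zero => simp
  | succ n ih =>
    rw [Function.iterate_succ_apply, pow_succ', pow_mul]
    exact (ih (T_nonneg hP m)).trans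
      (pow_le_pow_left₀ (S_nonneg (T_nonneg hP m) _) (S_T hP m (k + n)) _)

lemma S_add_tail {P : ℝ[X]} (hP : Prob P) {N : ℕ} (hN : P.natDegree < N) (k : ℕ) (hk : k ≤ N) :
    ∑ j ∈ Finset.Ico k N, P.coeff j = 1 - S P k := by
  have := hP.2
  rw [eval_eq_sum_range' hN] at this
  simp only [one_pow, mul_one] at this
  rw [Finset.sum_Ico_eq_sub _ hk, this]; rfl

lemma S_le_one {P : ℝ[X]} (hP : Prob P) (k : ℕ) : S P k ≤ 1 := by
  have h := S_add_tail hP (N := P.natDegree + 1 + k) (by omega) k (by omega)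
  have : 0 ≤ ∑ j ∈ Finset.Ico k (P.natDegree + 1 + k), P.coeff j := Finset.sum_nonneg fun _ _ => hP.1 _
  linarith

lemma coeff_le_tail {P : ℝ[X]} (hP : Prob P) {k j : ℕ} (hkj : k ≤ j) : P.coeff j ≤ 1 - S P k := by
  have h := S_add_tail hP (N := P.natDegree + 1 + j) (by omega) k (by omega)
  rw [← h]
  exact Finset.single_le_sum (f := fun j => P.coeff j) (fun i _ => hP.1 i)
    (by simp; omega)

lemma eval_le_S {P : ℝ[X]} (hP : Prob P) {x : ℝ} (hx : 0 ≤ x) (hx1 : x ≤ 1) (k : ℕ) :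
    P.eval x ≤ S P k + (1 - S P k) * x ^ k := by
  have hN : P.natDegree < P.natDegree + 1 + k := by omega
  rw [← S_add_tail hP hN k (by omega), eval_eq_sum_range' hN, S,
    ← Finset.sum_range_add_sum_Ico _ (show k ≤ P.natDegree + 1 + k by omega), Finset.sum_mul]
  refine add_le_add (Finset.sum_le_sum fun i _ => ?_) (Finset.sum_le_sum fun i hi => ?_)
  · exact mul_le_of_le_one_right (hP.1 i) (pow_le_one₀ hx hx1)
  · exact mul_le_mul_of_nonneg_left (pow_le_pow_of_le_one hx hx1 (Finset.mem_Ico.1 hi).1) (hP.1 i)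

lemma theta_le {m : ℕ} (hm : 2 ≤ m) : ((1 : ℝ) / 2) ^ (m - 1) ≤ 1 / 2 := by
  calc ((1 : ℝ) / 2) ^ (m - 1) ≤ (1 / 2) ^ 1 :=
        pow_le_pow_of_le_one (by norm_num) (by norm_num) (by omega)
    _ = 1 / 2 := by norm_num

lemma S_two_ge {m : ℕ} (hm : 2 ≤ m) {P : ℝ[X]} (hP : Prob P) (hF : 3 / 4 ≤ F m P) : 1 / 6 ≤ S P 2 := by
  unfold F at hF
  set x : ℝ := (1 / 2) ^ (m - 1) with hx
  have hx0 : 0 < x := by positivity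
  have hx1 : x ≤ 1 / 2 := theta_le hm
  have := eval_le_S hP hx0.le (by linarith) 2
  have h1 := S_le_one hP 2
  have : x ^ 2 ≤ 1 / 4 := by nlinarith
  nlinarith

lemma tail_bound {m : ℕ} (hm : 2 ≤ m) {P : ℝ[X]} (hP : Prob P) (k : ℕ)
    (hF : 3 / 4 ≤ F m ((T m)^[k] P)) : (m : ℝ) ^ k * (1 - S P (k + 2)) ≤ 5 := by
  have h1 := S_two_ge hm (hP.iter m k) hF
  have h2 := S_iter hP.1 m k 1
  rw [show 1 + k + 1 = k + 2 by omega] at h2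
  set q := 1 - S P (k + 2) with hq
  have hSq : S P (k + 2) = 1 - q := by rw [hq]; ring
  have hS0 := S_nonneg hP.1 (k + 2)
  have hq0 : 0 ≤ q := by have := S_le_one hP (k + 2); linarith
  rw [hSq] at h2 hS0
  have h3 : 1 + ((m ^ k : ℕ) : ℝ) * q ≤ (1 + q) ^ (m ^ k) := one_add_mul_le_pow (by linarith) _
  have h4 : (1 - q) ^ (m ^ k) * (1 + q) ^ (m ^ k) ≤ 1 := by
    rw [← mul_pow]
    exact pow_le_one₀ (by nlinarith) (by nlinarith)
  have h5 : 1 / 6 ≤ (1 - q) ^ (m ^ k) := h1.trans h2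
  have h6 : 0 ≤ (1 + q) ^ (m ^ k) := by positivity
  have h7 : (1 + q) ^ (m ^ k) ≤ 6 := by nlinarith
  push_cast at h3
  linarith

lemma F_ge_of_iter {m : ℕ} (hm : 2 ≤ m) {P : ℝ[X]} (hP : ∀ k, 0 ≤ P.coeff k) (n : ℕ)
    (hF : 3 / 4 ≤ F m ((T m)^[n] P)) : 3 / 4 ≤ F m P := by
  by_contra hc
  push Not at hc
  have h1 := F_iter hm hP n
  have h2 : F m P ^ (m ^ n) ≤ F m P := by
    apply pow_le_of_le_one (F_nonneg hP) (by linarith)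
    positivity
  linarith

lemma coeff_bound {m : ℕ} (hm : 2 ≤ m) {P : ℝ[X]} (hP : Prob P) (n k : ℕ) (hk : k ≤ n)
    (hF : 3 / 4 ≤ F m ((T m)^[n] P)) : P.coeff k ≤ 5 * m ^ 2 / m ^ k := by
  have hm0 : (0 : ℝ) < m := by positivity
  have hm1 : (1 : ℝ) ≤ m := by exact_mod_cast (by omega : 1 ≤ m)
  rw [le_div_iff₀ (by positivity)]
  rcases Nat.lt_or_ge k 2 with h | h
  · have h1 : P.coeff k ≤ 1 := by
      have := coeff_le_tail hP (k := 0) (j := k) (by omega)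
      simpa [S] using this
    have h2 : (m : ℝ) ^ k ≤ m ^ 2 := pow_le_pow_right₀ hm1 (by omega)
    have h3 := hP.1 k
    have h4 : (0 : ℝ) ≤ m ^ 2 := by positivity
    nlinarith
  · obtain ⟨j, rfl⟩ : ∃ j, k = j + 2 := ⟨k - 2, by omega⟩
    have h1 : 3 / 4 ≤ F m ((T m)^[j] P) := by
      apply F_ge_of_iter hm (hP.iter m j).1 (n - j)
      rwa [← Function.iterate_add_apply, show n - j + j = n by omega]
    have h2 := tail_bound hm hP j h1
    have h3 := coeff_le_tail hP (k := j + 2) (j := j + 2) le_rfl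
    have h4 : (m : ℝ) ^ j * P.coeff (j + 2) ≤ 5 :=
      (mul_le_mul_of_nonneg_left h3 (by positivity)).trans h2
    rw [pow_add]
    have h5 : (0 : ℝ) ≤ m ^ 2 := by positivity
    nlinarith

lemma s_deriv (P : ℝ[X]) (s : ℝ) {N : ℕ} (hN : P.natDegree < N) :
    s * P.derivative.eval s = ∑ k ∈ Finset.range N, P.coeff k * (k * s ^ k) := by
  rw [derivative_eval, sum_over_range' P (by simp) N hN, Finset.mul_sum]
  refine Finset.sum_congr rfl fun k _ => ?_
  rcases k with _ | k
  · simp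
  · rw [Nat.add_sub_cancel, pow_succ]; ring

lemma eval_T_le {m : ℕ} {P : ℝ[X]} (hP : ∀ k, 0 ≤ P.coeff k) {v : ℝ} (hv : 1 ≤ v) :
    (T m P).eval v ≤ P.eval v ^ m := by
  have h := T_eval m P v
  have h1 : P.coeff 0 ^ m ≤ P.eval v ^ m :=
    pow_le_pow_left₀ (hP 0) (coeff_zero_le_eval hP (by linarith)) m
  have : 0 ≤ (v - 1) * (P.eval v ^ m - P.coeff 0 ^ m) := mul_nonneg (by linarith) (by linarith)
  refine le_of_mul_le_mul_right (a := v) ?_ (by linarith)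
  linarith

lemma eval_iter_le {m : ℕ} {P : ℝ[X]} (hP : ∀ k, 0 ≤ P.coeff k) {v : ℝ} (hv : 1 ≤ v) (n : ℕ) :
    ((T m)^[n] P).eval v ≤ P.eval v ^ (m ^ n) := by
  induction n generalizing P with
  | zero => simp
  | succ n ih =>
    rw [Function.iterate_succ_apply, pow_succ', pow_mul]
    exact (ih (T_nonneg hP m)).trans
      (pow_le_pow_left₀ (eval_nonneg' (T_nonneg hP m) (by linarith)) (eval_T_le hP hv) _)

lemma H_iter {m : ℕ} (hm : 2 ≤ m) {δ : ℝ} (hδ : 0 < δ) {P : ℝ[X]} (hP : Prob P) {s : ℝ}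
    (hs : 1 ≤ s) (hsm : s ≤ m - δ) (h0 : 1 / 32 ≤ P.coeff 0) (hH : 0 ≤ H m P s) (n : ℕ) :
    δ / m * (1 / 32) ^ m * (m / (m - δ)) ^ n ≤ H m ((T m)^[n + 1] P) s := by
  have hm0 : (0 : ℝ) < m := by positivity
  have hs0 : 0 < s := by linarith
  induction n with
  | zero =>
    simp only [pow_zero, mul_one, zero_add, Function.iterate_one]
    refine le_trans ?_ (H_T_le hP hs hH)
    have h1 : 0 ≤ m / s * H m P s := by positivity
    have h2 : δ / m ≤ (m - s) / s := by
      rw [div_le_div_iff₀ hm0 hs0]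
      have : (m : ℝ) - s ≥ δ := by linarith
      nlinarith
    have h3 : ((1 : ℝ) / 32) ^ m ≤ P.coeff 0 ^ m := pow_le_pow_left₀ (by norm_num) h0 m
    have h4 : δ / m * (1 / 32) ^ m ≤ (m - s) / s * P.coeff 0 ^ m :=
      mul_le_mul h2 h3 (by positivity) (le_trans (by positivity) h2)
    linarith
  | succ n ih =>
    have hu : (0 : ℝ) < m - δ := by linarith
    have hpos : 0 ≤ δ / m * (1 / 32) ^ m * (m / (m - δ)) ^ n := by positivity
    rw [Function.iterate_succ_apply']
    have hQ := hP.iter m (n + 1)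
    refine le_trans ?_ (H_T_le hQ hs (hpos.trans ih))
    have h1 : 0 ≤ (m - s) / s * ((T m)^[n + 1] P).coeff 0 ^ m := by
      have := pow_nonneg (hQ.1 0) m
      have : 0 ≤ (m : ℝ) - s := by linarith
      positivity
    have h2 : (m : ℝ) / (m - δ) ≤ m / s := by gcongr
    have h3 : m / (m - δ) * (δ / m * (1 / 32) ^ m * (m / (m - δ)) ^ n) ≤
        m / s * H m ((T m)^[n + 1] P) s := mul_le_mul h2 ih hpos (by positivity)
    rw [pow_succ]
    linarith

lemma core (m : ℕ) (hm : 2 ≤ m) (δ : ℝ) (hδ0 : 0 < δ) (hδ1 : δ < 1) :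
    ∃ k1 : ℕ, 3 ≤ k1 ∧ ∀ (P : ℝ[X]) (L : ℕ) (s : ℝ), Prob P → P.natDegree ≤ L → 1 / 32 ≤ P.coeff 0 →
      1 ≤ s → s ≤ m - δ → 0 ≤ H m P s → F m ((T m)^[L + k1] P) < 3 / 4 := by
  have hm2 : (2 : ℝ) ≤ m := by exact_mod_cast hm
  have hm0 : (0 : ℝ) < m := by linarith
  obtain ⟨u, hu⟩ : ∃ u : ℝ, u = m - δ := ⟨_, rfl⟩
  obtain ⟨v, hv⟩ : ∃ v : ℝ, v = m - δ / 2 := ⟨_, rfl⟩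
  have hu1 : 1 < u := by linarith
  have huv : u < v := by linarith
  have hvm : v < m := by linarith
  have hv0 : 0 < v := by linarith
  have hsum1 : Summable fun k : ℕ => (k : ℝ) * (u / m) ^ k := by
    have := summable_pow_mul_geometric_of_norm_lt_one 1 (r := u / m) (by
      rw [Real.norm_of_nonneg (by positivity), div_lt_one hm0]; linarith)
    simpa using this
  have hsum2 : Summable fun k : ℕ => (v / m) ^ k :=
    summable_geometric_of_lt_one (by positivity) (by rw [div_lt_one hm0]; linarith)
  obtain ⟨C1, hC1⟩ : ∃ C1, C1 = 5 * (m : ℝ) ^ 2 * ∑' k : ℕ, (k : ℝ) * (u / m) ^ k := ⟨_, rfl⟩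
  obtain ⟨C2, hC2⟩ : ∃ C2, C2 = 5 * (m : ℝ) ^ 2 * ∑' k : ℕ, (v / m) ^ k := ⟨_, rfl⟩
  have hC2' : 0 ≤ C2 := by
    rw [hC2]
    exact mul_nonneg (by positivity) (tsum_nonneg fun k => by positivity)
  have hc : 0 < δ / m * (1 / 32) ^ m := by positivity
  obtain ⟨k0, hk0⟩ : ∃ k0 : ℕ, ((m : ℝ) - 1) * (C1 + 1) < δ / m * (1 / 32) ^ m * (m / u) ^ k0 := by
    obtain ⟨k0, h⟩ := pow_unbounded_of_one_lt
      (((m : ℝ) - 1) * (C1 + 1) / (δ / m * (1 / 32) ^ m)) (show 1 < m / u by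
        rw [one_lt_div (by linarith)]; linarith)
    refine ⟨k0, ?_⟩
    rw [div_lt_iff₀ hc] at h
    linarith
  obtain ⟨B, hB⟩ : ∃ B, B = C2 ^ (m ^ (k0 + 1)) := ⟨_, rfl⟩
  have hB0 : 0 ≤ B := by rw [hB]; positivity
  obtain ⟨K, hK⟩ : ∃ K : ℕ, ∀ k ≥ K, (k : ℝ) * (u / v) ^ k < 1 / (B + 1) := by
    have h := tendsto_self_mul_const_pow_of_lt_one (r := u / v) (by positivity)
      (by rw [div_lt_one hv0]; exact huv)
    have h2 := h.eventually (gt_mem_nhds (show (0 : ℝ) < 1 / (B + 1) by positivity))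
    exact Filter.eventually_atTop.1 h2
  refine ⟨K + (k0 + 1) + 3, by omega, ?_⟩
  intro P L s hP hdeg h0 hs hsm hH
  by_contra hcon
  push Not at hcon
  have hlow := H_iter hm hδ0 hP hs hsm h0 hH k0
  rw [← hu] at hlow hsm
  set Q := (T m)^[k0 + 1] P with hQdef
  have hQ : Prob Q := hP.iter m (k0 + 1)
  have hFQ : 3 / 4 ≤ F m ((T m)^[L + K + 3] Q) := by
    rw [hQdef, ← Function.iterate_add_apply, show L + K + 3 + (k0 + 1) = L + (K + (k0 + 1) + 3) by omega]
    exact hcon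
  -- bound on G_0(v)
  have hG0 : P.eval v ≤ C2 := by
    rw [eval_eq_sum_range' (Nat.lt_succ_of_le hdeg), hC2]
    calc ∑ k ∈ Finset.range (L + 1), P.coeff k * v ^ k
        ≤ ∑ k ∈ Finset.range (L + 1), 5 * (m : ℝ) ^ 2 * (v / m) ^ k := by
          refine Finset.sum_le_sum fun k hk => ?_
          have := coeff_bound hm hP _ k (by rw [Finset.mem_range] at hk; omega) hcon
          calc P.coeff k * v ^ k ≤ 5 * m ^ 2 / m ^ k * v ^ k := by gcongr
            _ = _ := by rw [div_pow]; ring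
      _ = 5 * (m : ℝ) ^ 2 * ∑ k ∈ Finset.range (L + 1), (v / m) ^ k := by rw [Finset.mul_sum]
      _ ≤ _ := by
          gcongr
          exact hsum2.sum_le_tsum _ (fun k _ => by positivity)
  have hGQ : Q.eval v ≤ B := by
    refine (eval_iter_le hP.1 (by linarith) (k0 + 1)).trans ?_
    rw [hB]
    exact pow_le_pow_left₀ (eval_nonneg' hP.1 hv0.le) hG0 _
  have hD : s * Q.derivative.eval s ≤ C1 + 1 := by
    rw [s_deriv Q s (Nat.lt_succ_self _)]
    calc ∑ k ∈ Finset.range (Q.natDegree + 1), Q.coeff k * (k * s ^ k)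
        ≤ ∑ k ∈ Finset.range (Q.natDegree + 1),
          (5 * (m : ℝ) ^ 2 * (k * (u / m) ^ k) + 1 / (B + 1) * (Q.coeff k * v ^ k)) := by
          refine Finset.sum_le_sum fun k hk => ?_
          have hq := hQ.1 k
          have hsu : Q.coeff k * (k * s ^ k) ≤ Q.coeff k * (k * u ^ k) := by gcongr
          refine hsu.trans ?_
          rcases Nat.lt_or_ge k K with hkK | hkK
          · have := coeff_bound hm hQ _ k (by omega : k ≤ L + K + 3) hFQ
            have h1 : Q.coeff k * (k * u ^ k) ≤ 5 * m ^ 2 / m ^ k * (k * u ^ k) := by gcongr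
            have h2 : 5 * (m : ℝ) ^ 2 / m ^ k * (k * u ^ k) = 5 * (m : ℝ) ^ 2 * (k * (u / m) ^ k) := by
              rw [div_pow]; ring
            have h3 : 0 ≤ 1 / (B + 1) * (Q.coeff k * v ^ k) := by positivity
            linarith
          · have h1 := (hK k hkK).le
            have h2 : Q.coeff k * (k * u ^ k) = (k * (u / v) ^ k) * (Q.coeff k * v ^ k) := by
              rw [div_pow]; field_simp
            have h3 : (k * (u / v) ^ k) * (Q.coeff k * v ^ k) ≤ 1 / (B + 1) * (Q.coeff k * v ^ k) := by
              gcongr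
            have h4 : 0 ≤ 5 * (m : ℝ) ^ 2 * (k * (u / m) ^ k) := by positivity
            linarith
      _ = 5 * (m : ℝ) ^ 2 * ∑ k ∈ Finset.range (Q.natDegree + 1), (k * (u / m) ^ k)
          + 1 / (B + 1) * Q.eval v := by
          rw [eval_eq_sum_range, Finset.sum_add_distrib, Finset.mul_sum, Finset.mul_sum]
      _ ≤ C1 + 1 := by
          refine add_le_add ?_ ?_
          · rw [hC1]
            gcongr
            exact hsum1.sum_le_tsum _ (fun k _ => by positivity)
          · rw [one_div, inv_mul_le_iff₀ (by positivity)]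
            linarith
  have hup : H m Q s ≤ ((m : ℝ) - 1) * (C1 + 1) := by
    unfold H
    have h1 := eval_nonneg' hQ.1 (x := s) (by linarith)
    have h2 := mul_le_mul_of_nonneg_left hD (show 0 ≤ (m : ℝ) - 1 by linarith)
    linarith
  linarith

open PowerSeries in
/-- One step on power series. -/
def TS (m : ℕ) (A : PowerSeries ℝ) : PowerSeries ℝ :=
  PowerSeries.mk fun j => PowerSeries.coeff (j + 1) (A ^ m) +
    if j = 0 then PowerSeries.coeff 0 (A ^ m) else 0

lemma hasSum_level (m : ℕ) (μ : ℕ → ℝ) (n : ℕ) :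
    HasSum (fun x : Fin m → ℕ => if (∑ i, x i) = n then ∏ i, μ (x i) else 0)
      (PowerSeries.coeff n ((PowerSeries.mk μ) ^ m)) := by
  have h1 : PowerSeries.coeff n ((PowerSeries.mk μ) ^ m) =
      ∑ x ∈ (Finset.univ : Finset (Fin m)).piAntidiag n,
        (if (∑ i, x i) = n then ∏ i, μ (x i) else 0) := by
    have : (PowerSeries.mk μ) ^ m = ∏ _i : Fin m, PowerSeries.mk μ := by simp
    rw [this, PowerSeries.coeff_prod]
    refine Finset.sum_bij (fun l _ => ⇑l) ?_ ?_ ?_ ?_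
    · intro l hl
      rw [Finset.mem_finsuppAntidiag] at hl
      rw [Finset.mem_piAntidiag]
      exact ⟨hl.1, by simp⟩
    · intro a _ b _ h
      exact DFunLike.coe_injective h
    · intro x hx
      rw [Finset.mem_piAntidiag] at hx
      refine ⟨Finsupp.equivFunOnFinite.symm x, ?_, by simp⟩
      rw [Finset.mem_finsuppAntidiag]
      exact ⟨by simpa using hx.1, by simp⟩
    · intro l hl
      rw [Finset.mem_finsuppAntidiag] at hl
      rw [if_pos hl.1]
      simp
  rw [h1]
  apply hasSum_sum_of_ne_finset_zero
  intro x hx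
  rw [if_neg]
  intro h
  exact hx (by rw [Finset.mem_piAntidiag]; exact ⟨h, by simp⟩)

lemma mk_drStep (m : ℕ) (μ : ℕ → ℝ) :
    PowerSeries.mk (drStep m μ) = TS m (PowerSeries.mk μ) := by
  ext j
  rw [PowerSeries.coeff_mk, TS, PowerSeries.coeff_mk]
  unfold drStep
  refine HasSum.tsum_eq ?_
  rcases j with _ | j
  · simp only [if_true]
    convert (hasSum_level m μ (0 + 1)).add (hasSum_level m μ 0) using 2 with x
    split_ifs <;> first | omega | simp
  · simp only [Nat.add_eq_zero_iff, one_ne_zero, and_false, if_false, add_zero]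
    convert (hasSum_level m μ (j + 1 + 1)) using 2 with x
    split_ifs <;> first | omega | simp

lemma mk_drLaw (m : ℕ) (ν : ℕ → ℝ) (p : ℝ) (n : ℕ) :
    PowerSeries.mk (drLaw m ν p n) = (TS m)^[n] (PowerSeries.mk (mix ν p)) := by
  unfold drLaw
  induction n with
  | zero => rfl
  | succ n ih =>
    rw [Function.iterate_succ_apply', Function.iterate_succ_apply', mk_drStep, ih]

lemma coe_T (m : ℕ) (P : ℝ[X]) : ((T m P : ℝ[X]) : PowerSeries ℝ) = TS m (P : PowerSeries ℝ) := by
  ext j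
  rw [TS, PowerSeries.coeff_mk, Polynomial.coeff_coe, ← Polynomial.coe_pow, Polynomial.coeff_coe,
    Polynomial.coeff_coe, coeff0_pow, T, coeff_add, coeff_divX, coeff_C]

lemma coe_T_iter (m : ℕ) (P : ℝ[X]) (n : ℕ) :
    (((T m)^[n] P : ℝ[X]) : PowerSeries ℝ) = (TS m)^[n] (P : PowerSeries ℝ) := by
  induction n with
  | zero => rfl
  | succ n ih => rw [Function.iterate_succ_apply', Function.iterate_succ_apply', coe_T, ih]

/-- nonnegative coefficients -/
def NN (A : PowerSeries ℝ) : Prop := ∀ k, 0 ≤ PowerSeries.coeff k A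

lemma NN.mul {A B : PowerSeries ℝ} (hA : NN A) (hB : NN B) : NN (A * B) := by
  intro k
  rw [PowerSeries.coeff_mul]
  exact Finset.sum_nonneg fun x _ => mul_nonneg (hA _) (hB _)

lemma NN.one : NN 1 := by
  intro k
  rw [PowerSeries.coeff_one]; split_ifs <;> norm_num

lemma NN.pow {A : PowerSeries ℝ} (hA : NN A) (n : ℕ) : NN (A ^ n) := by
  induction n with
  | zero => rw [pow_zero]; exact NN.one
  | succ n ih => rw [pow_succ]; exact ih.mul hA

lemma NN.TS {A : PowerSeries ℝ} (hA : NN A) (m : ℕ) : NN (TS m A) := by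
  intro k
  rw [DR.TS, PowerSeries.coeff_mk]
  have h1 := hA.pow m (k + 1)
  have h2 := hA.pow m 0
  split_ifs <;> linarith

lemma NN.sum {ι : Type*} {s : Finset ι} {f : ι → PowerSeries ℝ} (h : ∀ i ∈ s, NN (f i)) :
    NN (∑ i ∈ s, f i) := by
  intro k
  rw [map_sum]
  exact Finset.sum_nonneg fun i hi => h i hi k

/-- stochastic domination : `B` dominates `A`. -/
def Dom (A B : PowerSeries ℝ) : Prop := ∃ D, NN D ∧ A - B = (1 - PowerSeries.X) * D

lemma Dom.TS {A B : PowerSeries ℝ} (hA : NN A) (hB : NN B) (h : Dom A B) (m : ℕ) :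
    Dom (TS m A) (TS m B) := by
  obtain ⟨D, hD, hAB⟩ := h
  obtain ⟨E, hE⟩ : ∃ E, E = (∑ i ∈ Finset.range m, A ^ i * B ^ (m - 1 - i)) * D := ⟨_, rfl⟩
  have hEN : NN E := by
    rw [hE]
    exact (NN.sum fun i _ => (hA.pow _).mul (hB.pow _)).mul hD
  have hpow : A ^ m - B ^ m = E - PowerSeries.X * E := by
    rw [← geom_sum₂_mul, hAB, hE]; ring
  refine ⟨PowerSeries.mk fun j => PowerSeries.coeff (j + 1) E, fun k => ?_, ?_⟩
  · rw [PowerSeries.coeff_mk]; exact hEN _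
  · ext j
    have e0 := congrArg (PowerSeries.coeff 0) hpow
    have e1 := congrArg (PowerSeries.coeff (j + 1)) hpow
    rw [sub_mul, one_mul]
    simp only [map_sub, DR.TS, PowerSeries.coeff_mk, PowerSeries.coeff_succ_X_mul,
      PowerSeries.coeff_zero_X_mul, sub_zero] at e0 e1 ⊢
    rcases j with _ | j
    · simp only [if_true, PowerSeries.coeff_zero_X_mul] at *
      linarith
    · simp only [Nat.add_eq_zero_iff, one_ne_zero, and_false, if_false, add_zero,
        PowerSeries.coeff_succ_X_mul, PowerSeries.coeff_mk] at *
      linarith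

lemma NN.iter {A : PowerSeries ℝ} (hA : NN A) (m n : ℕ) : NN ((DR.TS m)^[n] A) := by
  induction n with
  | zero => exact hA
  | succ n ih => rw [Function.iterate_succ_apply']; exact ih.TS m

lemma Dom.iter {A B : PowerSeries ℝ} (hA : NN A) (hB : NN B) (h : Dom A B) (m n : ℕ) :
    Dom ((DR.TS m)^[n] A) ((DR.TS m)^[n] B) := by
  induction n with
  | zero => exact h
  | succ n ih =>
    rw [Function.iterate_succ_apply', Function.iterate_succ_apply']
    exact Dom.TS (hA.iter m n) (hB.iter m n) ih m

/-- Domination through partial sums. -/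
lemma dom_iff (A B : PowerSeries ℝ) : Dom A B ↔ ∀ k,
    ∑ j ∈ Finset.range (k + 1), PowerSeries.coeff j B ≤
    ∑ j ∈ Finset.range (k + 1), PowerSeries.coeff j A := by
  constructor
  · rintro ⟨D, hD, h⟩ k
    have : ∑ j ∈ Finset.range (k + 1), (PowerSeries.coeff j A - PowerSeries.coeff j B)
        = PowerSeries.coeff k D := by
      induction k with
      | zero =>
        have := congrArg (PowerSeries.coeff 0) h
        rw [sub_mul, one_mul] at this
        simpa [PowerSeries.coeff_zero_X_mul] using this
      | succ k ih =>
        have := congrArg (PowerSeries.coeff (k + 1)) h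
        rw [sub_mul, one_mul] at this
        simp only [map_sub, PowerSeries.coeff_succ_X_mul] at this
        rw [Finset.sum_range_succ, ih, this]; ring
    rw [Finset.sum_sub_distrib] at this
    have := hD k
    linarith
  · intro h
    refine ⟨PowerSeries.mk fun k => ∑ j ∈ Finset.range (k + 1),
      (PowerSeries.coeff j A - PowerSeries.coeff j B), fun k => ?_, ?_⟩
    · rw [PowerSeries.coeff_mk, Finset.sum_sub_distrib]
      linarith [h k]
    · ext j
      rw [sub_mul, one_mul]
      rcases j with _ | j
      · simp
      · simp only [map_sub, PowerSeries.coeff_succ_X_mul, PowerSeries.coeff_mk]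
        rw [Finset.sum_range_succ _ (j + 1)]
        ring

lemma TS_one (m : ℕ) : TS m 1 = 1 := by
  ext j
  rw [TS, PowerSeries.coeff_mk, one_pow, PowerSeries.coeff_one, PowerSeries.coeff_one,
    PowerSeries.coeff_one]
  simp

lemma partial_le_one {A : PowerSeries ℝ} (h : Dom 1 A) (k : ℕ) :
    ∑ j ∈ Finset.range k, PowerSeries.coeff j A ≤ 1 := by
  rcases k with _ | k
  · simp
  · refine ((dom_iff _ _).1 h k).trans (le_of_eq ?_)
    simp [PowerSeries.coeff_one]

lemma dom_one {A : PowerSeries ℝ} (h : ∀ k, ∑ j ∈ Finset.range k, PowerSeries.coeff j A ≤ 1) :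
    Dom 1 A := by
  rw [dom_iff]
  intro k
  refine (h (k + 1)).trans (le_of_eq ?_)
  simp [PowerSeries.coeff_one]

lemma dom_one_iter {A : PowerSeries ℝ} (hA : NN A) (h : Dom 1 A) (m n : ℕ) :
    Dom 1 ((TS m)^[n] A) := by
  have := Dom.iter NN.one hA h m n
  rwa [Function.iterate_fixed (TS_one m)] at this

/-- truncated law -/
def trunc (μ : ℕ → ℝ) (L : ℕ) : ℝ[X] :=
  ∑ j ∈ Finset.range L, monomial j (μ j) + monomial L (1 - ∑ j ∈ Finset.range L, μ j)

lemma trunc_coeff (μ : ℕ → ℝ) (L k : ℕ) : (trunc μ L).coeff k =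
    if k < L then μ k else if k = L then 1 - ∑ j ∈ Finset.range L, μ j else 0 := by
  unfold trunc
  rw [coeff_add, finsetSum_coeff]
  simp only [coeff_monomial, Finset.sum_ite_eq', Finset.mem_range]
  split_ifs <;> first | omega | simp

lemma trunc_natDegree (μ : ℕ → ℝ) (L : ℕ) : (trunc μ L).natDegree ≤ L := by
  rw [natDegree_le_iff_coeff_eq_zero]
  intro k hk
  rw [trunc_coeff, if_neg (by omega), if_neg (by omega)]

lemma trunc_sum (μ : ℕ → ℝ) (L : ℕ) (f : ℕ → ℝ) :
    ∑ k ∈ Finset.range (L + 1), (trunc μ L).coeff k * f k =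
    ∑ k ∈ Finset.range L, μ k * f k + (1 - ∑ j ∈ Finset.range L, μ j) * f L := by
  rw [Finset.sum_range_succ]
  congr 1
  · refine Finset.sum_congr rfl fun k hk => ?_
    rw [trunc_coeff, if_pos (Finset.mem_range.1 hk)]
  · rw [trunc_coeff, if_neg (by omega), if_pos rfl]

lemma trunc_prob {μ : ℕ → ℝ} (h0 : ∀ k, 0 ≤ μ k) (h1 : ∀ k, ∑ j ∈ Finset.range k, μ j ≤ 1) (L : ℕ) :
    Prob (trunc μ L) := by
  constructor
  · intro k
    rw [trunc_coeff]
    split_ifs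
    · exact h0 k
    · linarith [h1 L]
    · exact le_rfl
  · rw [eval_eq_sum_range' (Nat.lt_succ_of_le (trunc_natDegree μ L)), trunc_sum]
    simp

lemma trunc_dom {μ : ℕ → ℝ} (h1 : ∀ k, ∑ j ∈ Finset.range k, μ j ≤ 1) (L : ℕ) :
    Dom (trunc μ L : PowerSeries ℝ) (PowerSeries.mk μ) := by
  rw [dom_iff]
  intro k
  simp only [PowerSeries.coeff_mk, Polynomial.coeff_coe]
  rcases Nat.lt_or_ge k L with h | h
  · refine Finset.sum_le_sum fun j hj => ?_
    rw [Finset.mem_range] at hj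
    rw [trunc_coeff, if_pos (by omega)]
  · refine (h1 (k + 1)).trans (le_of_eq ?_)
    have hs : Finset.range (L + 1) ⊆ Finset.range (k + 1) := by
      intro x; simp only [Finset.mem_range]; omega
    rw [← Finset.sum_subset hs]
    · have := trunc_sum μ L (fun _ => 1)
      simp only [mul_one] at this
      rw [this]; ring
    · intro x _ hx
      simp only [Finset.mem_range] at hx
      rw [trunc_coeff, if_neg (by omega), if_neg (by omega)]

lemma trunc_H {μ : ℕ → ℝ} (h0 : ∀ k, 0 ≤ μ k) (h1 : ∀ k, ∑ j ∈ Finset.range k, μ j ≤ 1)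
    {m : ℕ} (hm : 2 ≤ m) {L : ℕ} (hL : 1 ≤ L) {s : ℝ} (hs : 1 ≤ s) :
    ∑' j : ℕ, (((m : ℝ) - 1) * ((min j L : ℕ) : ℝ) - 1) * s ^ (min j L) * μ j ≤ H m (trunc μ L) s := by
  have hsum : Summable μ := summable_of_sum_range_le h0 h1
  obtain ⟨f, hf⟩ : ∃ f : ℕ → ℝ, f = fun k : ℕ => (((m : ℝ) - 1) * (k : ℝ) - 1) * s ^ k := ⟨_, rfl⟩
  have hH : H m (trunc μ L) s = ∑ k ∈ Finset.range (L + 1), (trunc μ L).coeff k * f k := by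
    unfold H
    have hN := Nat.lt_succ_of_le (trunc_natDegree μ L)
    rw [s_deriv _ s hN, eval_eq_sum_range' hN, Finset.mul_sum, ← Finset.sum_sub_distrib]
    refine Finset.sum_congr rfl fun k _ => ?_
    rw [hf]; ring
  have hfun : (fun j : ℕ => (((m : ℝ) - 1) * ((min j L : ℕ) : ℝ) - 1) * s ^ (min j L) * μ j) =
      fun j => f (min j L) * μ j := by rw [hf]
  rw [hH, trunc_sum, hfun]
  have htail : Summable fun j => μ (j + L) := (summable_nat_add_iff L).2 hsum
  have heq : ∀ j, f (min (j + L) L) * μ (j + L) = f L * μ (j + L) := by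
    intro j; rw [min_eq_right (by omega)]
  have hS : Summable fun j => f (min j L) * μ j := by
    rw [← summable_nat_add_iff L]
    simp_rw [heq]
    exact htail.mul_left _
  rw [← hS.sum_add_tsum_nat_add L]
  simp_rw [heq]
  rw [tsum_mul_left]
  have h2 : ∑ j ∈ Finset.range L, μ j + ∑' j, μ (j + L) ≤ 1 := by
    rw [hsum.sum_add_tsum_nat_add L]
    exact Real.tsum_le_of_sum_range_le h0 h1
  have hfL : 0 ≤ f L := by
    rw [hf]
    have hm2 : (2 : ℝ) ≤ m := by exact_mod_cast hm
    have hL2 : (1 : ℝ) ≤ L := by exact_mod_cast hL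
    refine mul_nonneg ?_ (by positivity)
    nlinarith
  refine add_le_add (le_of_eq ?_) ?_
  · refine Finset.sum_congr rfl fun k hk => ?_
    rw [Finset.mem_range] at hk
    rw [min_eq_left (by omega), mul_comm]
  · rw [mul_comm]
    exact mul_le_mul_of_nonneg_right (by linarith) hfL

lemma TS_two_coeff (A : PowerSeries ℝ) :
    PowerSeries.coeff 0 (TS 2 A) = PowerSeries.coeff 0 A ^ 2 + 2 * PowerSeries.coeff 0 A * PowerSeries.coeff 1 A
    ∧ PowerSeries.coeff 1 (TS 2 A) = PowerSeries.coeff 1 A ^ 2 +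
      2 * PowerSeries.coeff 0 A * PowerSeries.coeff 2 A := by
  have a1 : Finset.HasAntidiagonal.antidiagonal 1 = ({(0, 1), (1, 0)} : Finset (ℕ × ℕ)) := by decide
  have a2 : Finset.HasAntidiagonal.antidiagonal 2 = ({(0, 2), (1, 1), (2, 0)} : Finset (ℕ × ℕ)) := by decide
  constructor
  · rw [TS, PowerSeries.coeff_mk, pow_two, PowerSeries.coeff_mul, PowerSeries.coeff_mul, zero_add, a1]
    simp
    ring
  · rw [TS, PowerSeries.coeff_mk, pow_two, PowerSeries.coeff_mul, a2]
    simp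
    ring

lemma two_step {A : PowerSeries ℝ} (hA : NN A) (h1 : Dom 1 A)
    (h : 3 / 4 ≤ PowerSeries.coeff 1 (TS 2 A)) :
    3 / 4 ≤ PowerSeries.coeff 1 A ∧
    3 / 2 * (1 - PowerSeries.coeff 0 A - PowerSeries.coeff 1 A) ≤
      1 - PowerSeries.coeff 0 (TS 2 A) - PowerSeries.coeff 1 (TS 2 A) := by
  obtain ⟨e0, e1⟩ := TS_two_coeff A
  rw [e1] at h
  rw [e0, e1]
  have hs := partial_le_one h1 3
  simp only [Finset.sum_range_succ, Finset.sum_range_zero, zero_add] at hs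
  have n0 := hA 0
  have n1 := hA 1
  have n2 := hA 2
  generalize PowerSeries.coeff 0 A = a at *
  generalize PowerSeries.coeff 1 A = b at *
  generalize PowerSeries.coeff 2 A = c at *
  have hb : 3 / 4 ≤ b := by
    by_contra hc
    push Not at hc
    have h2 : 4 * (a * c) ≤ (a + c) ^ 2 := by nlinarith [sq_nonneg (a - c)]
    have h3 : (a + c) ^ 2 ≤ (1 - b) ^ 2 := pow_le_pow_left₀ (by linarith) (by linarith) 2
    nlinarith
  refine ⟨hb, ?_⟩
  have h5 : 0 ≤ a * (1 - a - b - c) := mul_nonneg n0 (by linarith)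
  have h6 : 0 ≤ (1 - a - b) * (b - a - 1 / 2 ) := mul_nonneg (by linarith) (by linarith)
  nlinarith

lemma two_iter {A : PowerSeries ℝ} (hA : NN A) (h1 : Dom 1 A) (n : ℕ)
    (h : 3 / 4 ≤ PowerSeries.coeff 1 ((TS 2)^[n] A)) :
    3 / 4 ≤ PowerSeries.coeff 1 A ∧
    (3 / 2) ^ n * (1 - PowerSeries.coeff 0 A - PowerSeries.coeff 1 A) ≤
      1 - PowerSeries.coeff 0 ((TS 2)^[n] A) - PowerSeries.coeff 1 ((TS 2)^[n] A) := by
  induction n with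
  | zero => simpa using h
  | succ n ih =>
    rw [Function.iterate_succ_apply'] at *
    obtain ⟨a, b⟩ := two_step (hA.iter 2 n) (dom_one_iter hA h1 2 n) h
    obtain ⟨c, d⟩ := ih a
    refine ⟨c, ?_⟩
    rw [pow_succ]
    linarith

lemma F_small {m : ℕ} (hm : 2 ≤ m) {P : ℝ[X]} (hP : Prob P) (h0 : P.coeff 0 < 1 / 32)
    (h1 : m = 2 → P.coeff 1 < 3 / 4) : F m P ≤ 19 / 20 := by
  rcases Nat.lt_or_ge m 3 with h | h
  · obtain rfl : m = 2 := by omega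
    have h1 := h1 rfl
    unfold F
    norm_num
    have hN : P.natDegree < P.natDegree + 1 + 2 := by omega
    have hS : ∑ j ∈ Finset.Ico 2 (P.natDegree + 1 + 2), P.coeff j = 1 - S P 2 :=
      S_add_tail hP hN 2 (by omega)
    have hS2 : S P 2 = P.coeff 0 + P.coeff 1 := by simp [S, Finset.sum_range_succ]
    have : P.eval (1 / 2) ≤ P.coeff 0 + P.coeff 1 * (1 / 2) + (1 - S P 2) * (1 / 4) := by
      rw [eval_eq_sum_range' hN, ← Finset.sum_range_add_sum_Ico _ (show 2 ≤ P.natDegree + 1 + 2 by omega),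
        ← hS, Finset.sum_mul]
      refine add_le_add (le_of_eq (by simp [Finset.sum_range_succ])) (Finset.sum_le_sum fun i hi => ?_)
      refine mul_le_mul_of_nonneg_left ?_ (hP.1 i)
      calc ((1 : ℝ) / 2) ^ i ≤ (1 / 2) ^ 2 :=
            pow_le_pow_of_le_one (by norm_num) (by norm_num) (Finset.mem_Ico.1 hi).1
        _ = 1 / 4 := by norm_num
    linarith
  · unfold F
    have hx : ((1 : ℝ) / 2) ^ (m - 1) ≤ 1 / 4 := by
      calc ((1 : ℝ) / 2) ^ (m - 1) ≤ (1 / 2) ^ 2 :=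
            pow_le_pow_of_le_one (by norm_num) (by norm_num) (by omega)
        _ = 1 / 4 := by norm_num
    have hx0 : (0 : ℝ) < (1 / 2) ^ (m - 1) := by positivity
    generalize ((1 : ℝ) / 2) ^ (m - 1) = x at *
    have h2 := eval_le_S hP hx0.le (by linarith) 1
    have hS1 : S P 1 = P.coeff 0 := by simp [S]
    have := hP.1 0
    rw [hS1, pow_one] at h2
    nlinarith

lemma mix_facts {ν : ℕ → ℝ} (hn : ∀ k, 0 ≤ ν k) (h1 : ∑' k, ν k = 1) {p : ℝ}
    (hp : p ∈ Set.Ioo (0 : ℝ) 1) :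
    NN (PowerSeries.mk (mix ν p)) ∧ Dom 1 (PowerSeries.mk (mix ν p)) := by
  have hs : Summable ν := by
    by_contra hc
    rw [tsum_eq_zero_of_not_summable hc] at h1
    norm_num at h1
  constructor
  · intro k
    rw [PowerSeries.coeff_mk, mix]
    have := mul_nonneg hp.1.le (hn k)
    have := hp.2
    split_ifs <;> linarith
  · refine dom_one fun k => ?_
    simp only [PowerSeries.coeff_mk, mix]
    rw [Finset.sum_add_distrib, ← Finset.mul_sum, ← Finset.mul_sum]
    have e1 : ∑ j ∈ Finset.range k, ν j ≤ 1 := h1 ▸ hs.sum_le_tsum _ (fun i _ => hn i)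
    have e2 : ∑ j ∈ Finset.range k, (if j = 0 then (1 : ℝ) else 0) ≤ 1 := by
      rw [Finset.sum_ite_eq' (Finset.range k) 0]
      split_ifs <;> norm_num
    have := hp.1
    have := hp.2
    nlinarith

lemma not_one {ν : ℕ → ℝ} (h0 : ν 0 = 0) (hn : ∀ k, 0 ≤ ν k) (h1 : ∑' k, ν k = 1)
    {c1 : ℝ} (hc : c1 = ∑' j : ℕ, ν (j + 2)) (hc0 : 0 < c1) {n2 : ℕ}
    (hn2 : (n2 : ℤ) = ⌊Real.log (1 / c1) / Real.log (5 / 4)⌋ + 1) {p : ℝ}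
    (hp : p ∈ Set.Ioo (0 : ℝ) 1) {i : ℕ} (hi : n2 ≤ i) : drLaw 2 ν p i 1 < 3 / 4 := by
  by_contra hcon
  push Not at hcon
  have hs : Summable ν := by
    by_contra hc
    rw [tsum_eq_zero_of_not_summable hc] at h1
    norm_num at h1
  obtain ⟨hA, hD⟩ := mix_facts hn h1 hp
  have e : drLaw 2 ν p i 1 = PowerSeries.coeff 1 ((TS 2)^[i] (PowerSeries.mk (mix ν p))) := by
    rw [← mk_drLaw, PowerSeries.coeff_mk]
  rw [e] at hcon
  obtain ⟨ha, hb⟩ := two_iter hA hD i hcon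
  have hq0 := hA.iter 2 i 0
  simp only [PowerSeries.coeff_mk, mix, h0] at ha hb
  norm_num at ha hb
  have hc' : ν 1 + c1 = 1 := by
    have := hs.sum_add_tsum_nat_add 2
    rw [h1, ← hc] at this
    simpa [Finset.sum_range_succ, h0] using this
  have hp34 : 3 / 4 ≤ p := by have := hp.1; nlinarith
  have hpow : 1 < c1 * (5 / 4) ^ n2 := by
    have hl : 0 < Real.log (5 / 4) := Real.log_pos (by norm_num)
    have h2 : Real.log (1 / c1) / Real.log (5 / 4) < n2 := by
      have := Int.lt_floor_add_one (Real.log (1 / c1) / Real.log (5 / 4))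
      have h3 : ((n2 : ℤ) : ℝ) = (⌊Real.log (1 / c1) / Real.log (5 / 4)⌋ : ℝ) + 1 := by
        rw [hn2]; push_cast; rfl
      push_cast at h3
      linarith
    rw [div_lt_iff₀ hl, ← Real.log_pow] at h2
    have h3 := (Real.log_lt_log_iff (by positivity) (by positivity)).1 h2
    rw [div_lt_iff₀ hc0] at h3
    linarith
  have hpow2 : ((5 : ℝ) / 4) ^ n2 ≤ (3 / 2) ^ i :=
    calc ((5 : ℝ) / 4) ^ n2 ≤ (3 / 2) ^ n2 := pow_le_pow_left₀ (by norm_num) (by norm_num) _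
      _ ≤ (3 / 2) ^ i := pow_le_pow_right₀ (by norm_num) hi
  have h5 : p - p * ν 1 = p * c1 := by linear_combination (-p) * hc'
  rw [h5] at hb
  have h6 : 1 < c1 * (3 / 2) ^ i := hpow.trans_le (mul_le_mul_of_nonneg_left hpow2 hc0.le)
  have h7 : p < (3 / 2) ^ i * (p * c1) := by
    have := hp.1
    nlinarith
  norm_num at hq0
  linarith

end DR

/-- Theorem 4.5. Fix `δ ∈ (0,1)` and assume `c_1 = P(X_0^* ≥ 2) > 0`.
If for some `n_2 ≤ i ≤ M - 2` (with `M ≥ n_2 + 2`) and some `s ∈ [1, m-δ]` one has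
`E(((m-1)X_i^{(M)} - 1)s^{X_i^{(M)}}) ≥ 0`, then there are constants `c_6, c_7 > 0`
depending only on `(m, δ)` with `P(X_n = 0) ≤ c_7 exp(-c_6 m^{n-M})` for all `n ≥ M`. -/
theorem truncated_supercritical_decay
    (m : ℕ) (hm : 2 ≤ m) (δ : ℝ) (hδ : δ ∈ Set.Ioo (0 : ℝ) 1) :
    ∃ c6 c7 : ℝ, 0 < c6 ∧ 0 < c7 ∧
      ∀ ν : ℕ → ℝ, ν 0 = 0 → (∀ k, 0 ≤ ν k) → (∑' k, ν k = 1) →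
      ∀ c1 : ℝ, c1 = ∑' j : ℕ, ν (j + 2) → 0 < c1 →
      ∀ n2 : ℕ, (n2 : ℤ) = ⌊Real.log (1 / c1) / Real.log (5 / 4)⌋ + 1 →
      ∀ p ∈ Set.Ioo (0 : ℝ) 1,
      ∀ M i : ℕ, n2 + 2 ≤ M → n2 ≤ i → i + 2 ≤ M →
      ∀ s : ℝ, 1 ≤ s → s ≤ (m : ℝ) - δ →
        0 ≤ (∑' j : ℕ, (((m : ℝ) - 1) * ((min j (M - i) : ℕ) : ℝ) - 1) *
              s ^ (min j (M - i)) * drLaw m ν p i j) →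
        ∀ n : ℕ, M ≤ n →
          drLaw m ν p n 0 ≤ c7 * Real.exp (-c6 * (m : ℝ) ^ (n - M)) := by
  obtain ⟨k1, hk1, hcore⟩ := DR.core m hm δ hδ.1 hδ.2
  have hm2 : (2 : ℝ) ≤ m := by exact_mod_cast hm
  have hm0 : (0 : ℝ) < m := by linarith
  have hlog : 0 < Real.log (4 / 3) := Real.log_pos (by norm_num)
  refine ⟨Real.log (4 / 3) / (m : ℝ) ^ k1, 4 / 3, by positivity, by norm_num, ?_⟩
  intro ν h0 hn h1 c1 hc hc0 n2 hn2 p hp M i hM hi hiM s hs hsm hH n hMn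
  obtain ⟨hA, hD⟩ := DR.mix_facts hn h1 hp
  have hcoef : ∀ n j, drLaw m ν p n j =
      PowerSeries.coeff j ((DR.TS m)^[n] (PowerSeries.mk (mix ν p))) := by
    intro n j
    rw [← DR.mk_drLaw, PowerSeries.coeff_mk]
  have hnn : ∀ n j, 0 ≤ drLaw m ν p n j := fun n j => by rw [hcoef]; exact hA.iter m n j
  have hle : ∀ n k, ∑ j ∈ Finset.range k, drLaw m ν p n j ≤ 1 := by
    intro n k
    simp_rw [hcoef]
    exact DR.partial_le_one (DR.dom_one_iter hA hD m n) k
  rcases Nat.lt_or_ge n (M + k1) with hlt | hge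
  · have h2 : drLaw m ν p n 0 ≤ 1 := by simpa using hle n 1
    have h3 : (m : ℝ) ^ (n - M) / (m : ℝ) ^ k1 ≤ 1 := by
      rw [div_le_one (by positivity)]
      exact pow_le_pow_right₀ (by linarith) (by omega)
    have h4 : Real.exp (-Real.log (4 / 3)) ≤
        Real.exp (-(Real.log (4 / 3) / (m : ℝ) ^ k1) * (m : ℝ) ^ (n - M)) := by
      apply Real.exp_le_exp.2
      have : -(Real.log (4 / 3) / (m : ℝ) ^ k1) * (m : ℝ) ^ (n - M) =
        -(Real.log (4 / 3) * ((m : ℝ) ^ (n - M) / (m : ℝ) ^ k1)) := by ring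
      rw [this]
      nlinarith
    rw [Real.exp_neg, Real.exp_log (by norm_num)] at h4
    linarith
  · obtain ⟨L, hL⟩ : ∃ L, L = M - i := ⟨_, rfl⟩
    rw [← hL] at hH
    obtain ⟨Y, hY⟩ : ∃ Y, Y = DR.trunc (drLaw m ν p i) L := ⟨_, rfl⟩
    have hYP : DR.Prob Y := hY ▸ DR.trunc_prob (hnn i) (hle i) L
    have hYH : 0 ≤ DR.H m Y s := by
      rw [hY]
      exact hH.trans (DR.trunc_H (hnn i) (hle i) hm (by omega) hs)
    have hF : DR.F m ((DR.T m)^[L + k1] Y) < 3 / 4 := by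
      rcases le_or_gt (1 / 32) (Y.coeff 0) with hc | hc
      · exact hcore Y L s hYP (hY ▸ DR.trunc_natDegree _ L) hc hs hsm hYH
      · have h2 : DR.F m Y ≤ 19 / 20 := by
          apply DR.F_small hm hYP hc
          rintro rfl
          rw [hY, DR.trunc_coeff, if_pos (by omega)]
          exact DR.not_one h0 hn h1 (by assumption) hc0 hn2 hp hi
        have h3 := DR.F_iter hm hYP.1 (L + k1)
        have h4 : 8 ≤ m ^ (L + k1) :=
          calc 8 = 2 ^ 3 := by norm_num
            _ ≤ m ^ 3 := Nat.pow_le_pow_left hm 3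
            _ ≤ m ^ (L + k1) := Nat.pow_le_pow_right (by omega) (by omega)
        calc _ ≤ DR.F m Y ^ (m ^ (L + k1)) := h3
          _ ≤ (19 / 20) ^ (m ^ (L + k1)) := pow_le_pow_left₀ (DR.F_nonneg hYP.1) h2 _
          _ ≤ (19 / 20) ^ 8 := pow_le_pow_of_le_one (by norm_num) (by norm_num) h4
          _ < 3 / 4 := by norm_num
    have hYNN : DR.NN (Y : PowerSeries ℝ) := by
      intro k
      rw [Polynomial.coeff_coe]; exact hYP.1 k
    have hdom : DR.Dom (Y : PowerSeries ℝ) ((DR.TS m)^[i] (PowerSeries.mk (mix ν p))) := by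
      rw [← DR.mk_drLaw, hY]
      exact DR.trunc_dom (hle i) L
    have hdom2 := DR.Dom.iter hYNN (hA.iter m i) hdom m (n - i)
    rw [← Function.iterate_add_apply, show n - i + i = n by omega, ← DR.coe_T_iter] at hdom2
    have h5 := (DR.dom_iff _ _).1 hdom2 0
    simp only [zero_add, Finset.sum_range_one, ← hcoef, Polynomial.coeff_coe] at h5
    have hYn := hYP.iter m (n - i)
    have h6 := h5.trans (DR.coeff_zero_le_F (m := m) hYn.1)
    obtain ⟨d, hd⟩ : ∃ d, n = M + k1 + d := ⟨n - (M + k1), by omega⟩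
    have h7 : n - i = d + (L + k1) := by omega
    rw [h7, Function.iterate_add_apply] at h6
    have hZ := hYP.iter m (L + k1)
    have h8 := h6.trans (DR.F_iter hm hZ.1 d)
    have h9 : drLaw m ν p n 0 ≤ (3 / 4) ^ (m ^ d) :=
      h8.trans (pow_le_pow_left₀ (DR.F_nonneg hZ.1) hF.le _)
    have h10 : Real.exp (-(Real.log (4 / 3) / (m : ℝ) ^ k1) * (m : ℝ) ^ (n - M)) =
        (3 / 4) ^ (m ^ d) := by
      rw [show n - M = d + k1 by omega, pow_add]
      have : -(Real.log (4 / 3) / (m : ℝ) ^ k1) * ((m : ℝ) ^ d * (m : ℝ) ^ k1) =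
        ((m ^ d : ℕ) : ℝ) * (-Real.log (4 / 3)) := by
        push_cast
        field_simp
      rw [this, Real.exp_nat_mul, Real.exp_neg, Real.exp_log (by norm_num)]
      norm_num
    rw [h10]
    have : (0 : ℝ) ≤ (3 / 4) ^ (m ^ d) := by positivity
    linarith
end
end
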